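/- arXiv:2410.09483 — 5 statements merged into one kernel-verified Lean document; each statement's English description precedes it below -/
import Mathlib

section
/- Let (R, r) be a dévissage setup and let n ≥ k ≥ 1 be integers. Let N be a finitely generated projective R/rⁿR-module and let M be a finitely generated projective R/rᵏR-module, viewed as an R/rⁿR-module through the quotient map R/rⁿR → R/rᵏR. Then Ext¹_{R/rⁿR}(M, N) = 0. -/
open Pointwise

universe u

section Core

variable {R : Type u} [CommRing R]

/-- A dévissage setup: `R` is `r`-torsion-free and `r`-adically complete and separated. -/
structure IsDevissageSetup (R : Type u) [CommRing R] (r : R) : Prop where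
  torsionFree : ∀ x : R, r * x = 0 → x = 0
  adicComplete : IsAdicComplete (Ideal.span {r}) R

/-- `Q` has constant rank over `A`: localization at every prime is free of a fixed rank. -/
def ConstRank (A : Type u) [CommRing A] (Q : Type u) [AddCommGroup Q] [Module A Q] : Prop :=
  ∃ c : ℕ, ∀ (p : Ideal A) (_ : p.IsPrime),
    Nonempty ((LocalizedModule p.primeCompl Q) ≃ₗ[Localization.AtPrime p]
      (Fin c → Localization.AtPrime p))

/-- finitely generated, projective, of constant rank -/
def FinProjConstRank (A : Type u) [CommRing A] (Q : Type u) [AddCommGroup Q] [Module A Q] : Prop :=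
  Module.Finite A Q ∧ Module.Projective A Q ∧ ConstRank A Q

/-- the subquotient `rⁿM/rⁿ⁺¹M`, realized as a submodule of `M/rⁿ⁺¹M`. -/
def muQuotSub (r : R) (M : Type u) [AddCommGroup M] [Module R M] (n : ℕ) :
    Submodule R (M ⧸ (r ^ (n + 1) • (⊤ : Submodule R M))) :=
  (r ^ n • (⊤ : Submodule R M)).map (r ^ (n + 1) • (⊤ : Submodule R M)).mkQ

theorem muQuotSub_isTorsionBySet (r : R) (M : Type u) [AddCommGroup M] [Module R M] (n : ℕ) :
    Module.IsTorsionBySet R (muQuotSub r M n) ((Ideal.span {r} : Ideal R) : Set R) := by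
  refine (Module.isTorsionBySet_span_singleton_iff r).mpr ?_
  rintro ⟨x, hx⟩
  obtain ⟨m, hm, rfl⟩ := hx
  obtain ⟨m', -, rfl⟩ := hm
  apply Subtype.ext
  show r • ((r ^ (n + 1) • (⊤ : Submodule R M)).mkQ
      ((DistribMulAction.toLinearMap R M (r ^ n) : M →ₗ[R] M) m')) = 0
  rw [← map_smul]
  rw [Submodule.mkQ_apply, Submodule.Quotient.mk_eq_zero]
  show r • r ^ n • m' ∈ r ^ (n + 1) • (⊤ : Submodule R M)
  rw [smul_smul, ← pow_succ']
  exact Submodule.smul_mem_pointwise_smul _ _ _ Submodule.mem_top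

/-- `M` has finite projective `(r,μ)`-dévissage. -/
def HasFinProjMuDevissage (r : R) (M : Type u) [AddCommGroup M] [Module R M] : Prop :=
  ∀ n : ℕ,
    letI := (muQuotSub_isTorsionBySet r M n).module
    FinProjConstRank (R ⧸ (Ideal.span {r} : Ideal R)) (muQuotSub r M n)

/-- `M` has bounded `r^∞`-torsion. -/
def BoundedRTorsion (r : R) (M : Type u) [AddCommGroup M] [Module R M] : Prop :=
  ∃ N : ℕ, 1 ≤ N ∧ ∀ x : M, (∃ k : ℕ, r ^ k • x = 0) → r ^ N • x = 0

end Core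

theorem ext_core {A P₁ P₀ M N : Type u} [CommRing A] [AddCommGroup P₁] [Module A P₁]
    [AddCommGroup P₀] [Module A P₀] [AddCommGroup M] [Module A M] [AddCommGroup N] [Module A N]
    [Module.Projective A P₀] (a b : A) (hab : b * a = 0)
    (hN : ∀ x : N, b • x = 0 → ∃ y : N, x = a • y)
    (m : ℕ) (p : (Fin m → A) →ₗ[A] M) (s : M →ₗ[A] (Fin m → A ⧸ Ideal.span {a}))
    (hs : ∀ (x : M) (y : Fin m → A), (∀ i, Ideal.Quotient.mk (Ideal.span {a}) (y i) = s x i) → p y = x)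
    (d : P₁ →ₗ[A] P₀) (π : P₀ →ₗ[A] M) (hπ : Function.Surjective π)
    (hex : ∀ x, π x = 0 ↔ ∃ z, d z = x)
    (f : P₁ →ₗ[A] N) (hf : ∀ x, d x = 0 → f x = 0) :
    ∃ h : P₀ →ₗ[A] N, h ∘ₗ d = f := by
  -- lift the generators
  choose x hx using fun i : Fin m => hπ (p (Pi.single i 1))
  have hpa : ∀ y : Fin m → A, p (a • y) = 0 := by
    intro y
    apply hs
    intro i
    simp only [map_zero, Pi.zero_apply, Pi.smul_apply, smul_eq_mul]
    rw [Ideal.Quotient.eq_zero_iff_mem]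
    exact Ideal.mul_mem_right _ _ (Ideal.mem_span_singleton_self a)
  have hax : ∀ i, ∃ c, d c = a • x i := by
    intro i
    rw [← hex, map_smul, hx, ← map_smul, hpa]
  choose c hc using hax
  have hn : ∀ i, ∃ y, f (c i) = a • y := by
    intro i
    apply hN
    rw [← map_smul]
    apply hf
    rw [map_smul, hc, smul_smul, hab, zero_smul]
  choose ν hν using hn
  let ψ : (Fin m → A) →ₗ[A] P₀ := Fintype.linearCombination A x
  let γ : (Fin m → A) →ₗ[A] P₁ := Fintype.linearCombination A c
  let ω : (Fin m → A) →ₗ[A] N := Fintype.linearCombination A ν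
  let Q : (Fin m → A) →ₗ[A] (Fin m → A ⧸ Ideal.span {a}) :=
    LinearMap.pi fun i => (Submodule.mkQ (Ideal.span {a})) ∘ₗ LinearMap.proj i
  have hQ : Function.Surjective Q := by
    intro z
    choose y hy using fun i => Ideal.Quotient.mk_surjective (I := Ideal.span {a}) (z i)
    exact ⟨y, funext hy⟩
  obtain ⟨θ, hθ⟩ := Module.projective_lifting_property Q (s ∘ₗ π) hQ
  have hθ' : ∀ z, Q (θ z) = s (π z) := fun z => LinearMap.congr_fun hθ z
  have hpθ : ∀ z, p (θ z) = π z := fun z => hs _ _ fun i => congrFun (hθ' z) i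
  have hπψ : ∀ y, π (ψ y) = p y := by
    have : π ∘ₗ ψ = p := by
      refine LinearMap.pi_ext' fun i => LinearMap.ext_ring ?_
      simp [ψ, Fintype.linearCombination_apply_single, hx]
    exact fun y => LinearMap.congr_fun this y
  have hdγ : ∀ y, d (γ y) = a • ψ y := by
    have : d ∘ₗ γ = a • ψ := by
      refine LinearMap.pi_ext' fun i => LinearMap.ext_ring ?_
      simp [ψ, γ, Fintype.linearCombination_apply_single, hc]
    exact fun y => LinearMap.congr_fun this y
  have hfγ : ∀ y, f (γ y) = a • ω y := by
    have : f ∘ₗ γ = a • ω := by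
      refine LinearMap.pi_ext' fun i => LinearMap.ext_ring ?_
      simp [ω, γ, Fintype.linearCombination_apply_single, hν]
    exact fun y => LinearMap.congr_fun this y
  have hmem : ∀ z, ((LinearMap.id : P₀ →ₗ[A] P₀) - ψ ∘ₗ θ : P₀ →ₗ[A] P₀) z ∈ LinearMap.range d := by
    intro z
    refine (hex _).1 ?_
    simp [hπψ, hpθ]
  obtain ⟨χ, hχ⟩ := Module.projective_lifting_property d.rangeRestrict
    (LinearMap.codRestrict (LinearMap.range d) ((LinearMap.id : P₀ →ₗ[A] P₀) - ψ ∘ₗ θ) hmem) d.surjective_rangeRestrict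
  have hχ' : ∀ z, d (χ z) = z - ψ (θ z) := fun z =>
    congrArg Subtype.val (LinearMap.congr_fun hχ z)
  refine ⟨f ∘ₗ χ + ω ∘ₗ θ, LinearMap.ext fun z => ?_⟩
  have hy : ∃ y, θ (d z) = a • y := by
    have h0 : Q (θ (d z)) = 0 := by
      rw [hθ', (hex _).2 ⟨z, rfl⟩, map_zero]
    have : ∀ i, ∃ y, θ (d z) i = a * y := fun i => by
      have := congrFun h0 i
      exact Ideal.mem_span_singleton.1 (Ideal.Quotient.eq_zero_iff_mem.1 this)
    choose y hy using this
    exact ⟨y, funext hy⟩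
  obtain ⟨y, hy⟩ := hy
  have key : f (χ (d z) - z + γ y) = 0 := by
    apply hf
    rw [map_add, map_sub, hχ', hdγ, hy, map_smul]
    abel
  rw [map_add, map_sub, hfγ] at key
  simp only [LinearMap.comp_apply, LinearMap.add_apply, hy, map_smul]
  rw [← sub_eq_zero, ← key]
  abel

theorem proj_tors {A N : Type u} [CommRing A] [AddCommGroup N] [Module A N]
    [Module.Projective A N] (a b : A) (h : ∀ x : A, b * x = 0 → ∃ y, x = a * y)
    (x : N) (hx : b • x = 0) : ∃ y : N, x = a • y := by
  obtain ⟨s, hs⟩ := Module.projective_def'.1 (inferInstance : Module.Projective A N)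
  have h1 : b • s x = 0 := by rw [← map_smul, hx, map_zero]
  have h2 : ∀ i, ∃ y, s x i = a * y := fun i => h _ (by simpa using DFunLike.congr_fun h1 i)
  choose y hy using h2
  have h3 : s x = a • ∑ i ∈ (s x).support, Finsupp.single i (y i) := by
    conv_lhs => rw [← Finsupp.sum_single (s x), Finsupp.sum]
    rw [Finset.smul_sum]
    refine Finset.sum_congr rfl fun i _ => ?_
    rw [Finsupp.smul_single, smul_eq_mul, ← hy]
  refine ⟨Finsupp.linearCombination A id (∑ i ∈ (s x).support, Finsupp.single i (y i)), ?_⟩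
  rw [← map_smul, ← h3]
  exact (LinearMap.congr_fun hs x).symm

theorem retract_data {R : Type u} [CommRing R] (I : Ideal R) (M : Type u) [AddCommGroup M]
    [Module R M] [Module (R ⧸ I) M] [IsScalarTower R (R ⧸ I) M]
    [Module.Finite (R ⧸ I) M] [Module.Projective (R ⧸ I) M]
    (J : Ideal R) [Module (R ⧸ J) M] [IsScalarTower R (R ⧸ J) M] (hJI : J ≤ I)
    (a : R ⧸ J) (ha : ∀ x : R, Ideal.Quotient.mk J x ∈ Ideal.span {a} ↔ x ∈ I) :
    ∃ (m : ℕ) (p : (Fin m → R ⧸ J) →ₗ[R ⧸ J] M)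
      (s : M →ₗ[R ⧸ J] (Fin m → (R ⧸ J) ⧸ Ideal.span {a})),
      ∀ (x : M) (y : Fin m → R ⧸ J),
        (∀ i, Ideal.Quotient.mk (Ideal.span {a}) (y i) = s x i) → p y = x := by
  obtain ⟨m, q, hq⟩ := Module.Finite.exists_fin' (R ⧸ I) M
  obtain ⟨t, ht⟩ := Module.projective_lifting_property q LinearMap.id hq
  have ht' : ∀ x, q (t x) = x := fun x => LinearMap.congr_fun ht x
  let e : (R ⧸ I) →ₗ[R] ((R ⧸ J) ⧸ Ideal.span {a}) :=
    Submodule.liftQ I ((Submodule.mkQ (Ideal.span {a})).restrictScalars R ∘ₗ Submodule.mkQ J)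
      (fun x hx => (Ideal.Quotient.eq_zero_iff_mem (I := Ideal.span {a})).2 ((ha x).2 hx))
  have he : ∀ x : R, e (Ideal.Quotient.mk I x) =
    Ideal.Quotient.mk (Ideal.span {a}) (Ideal.Quotient.mk J x) := fun x => rfl
  have heinj : ∀ x, e x = 0 → x = 0 := by
    intro x hx
    obtain ⟨x, rfl⟩ := Ideal.Quotient.mk_surjective x
    rw [he, Ideal.Quotient.eq_zero_iff_mem, ha] at hx
    exact Ideal.Quotient.eq_zero_iff_mem.2 hx
  let w : (R ⧸ J) →ₗ[R] (R ⧸ I) := Submodule.mapQ J I LinearMap.id hJI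
  have hw : ∀ x : R, w (Ideal.Quotient.mk J x) = Ideal.Quotient.mk I x := fun x => rfl
  have hew : ∀ x, e (w x) = Ideal.Quotient.mk (Ideal.span {a}) x := by
    intro x
    obtain ⟨x, rfl⟩ := Ideal.Quotient.mk_surjective x
    rfl
  have hsurj : Function.Surjective (algebraMap R (R ⧸ J)) := Ideal.Quotient.mk_surjective
  let p₀ : (Fin m → R ⧸ J) →ₗ[R] M :=
    q.restrictScalars R ∘ₗ LinearMap.pi fun i => w ∘ₗ LinearMap.proj i
  let s₀ : M →ₗ[R] (Fin m → (R ⧸ J) ⧸ Ideal.span {a}) :=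
    (LinearMap.pi fun i => e ∘ₗ LinearMap.proj i) ∘ₗ t.restrictScalars R
  refine ⟨m, p₀.extendScalarsOfSurjective hsurj, s₀.extendScalarsOfSurjective hsurj, ?_⟩
  intro x y h
  have h1 : (fun i => w (y i)) = t x := by
    funext i
    rw [← sub_eq_zero]
    apply heinj
    rw [map_sub, hew, sub_eq_zero]
    exact h i
  change q (fun i => w (y i)) = x
  rw [h1, ht']

theorem ext_zero_of_core (A : Type u) [CommRing A] (M N : ModuleCat.{u} A)
    (H : ∀ (P₁ P₀ : ModuleCat.{u} A) [Module.Projective A P₀] (d : P₁ →ₗ[A] P₀) (π : P₀ →ₗ[A] M)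
      (_ : Function.Surjective π) (_ : ∀ x, π x = 0 ↔ ∃ z, d z = x)
      (f : P₁ →ₗ[A] N) (_ : ∀ x, d x = 0 → f x = 0),
      ∃ h : P₀ →ₗ[A] N, h ∘ₗ d = f) :
    CategoryTheory.Limits.IsZero
      ((((Ext A (ModuleCat.{u} A) 1).obj (Opposite.op M)).obj N) : ModuleCat _) := by
  let P := CategoryTheory.projectiveResolution M
  refine CategoryTheory.Limits.IsZero.of_iso ?_ (P.isoExt 1 N)
  rw [← HomologicalComplex.exactAt_iff_isZero_homology,
    HomologicalComplex.exactAt_iff' _ 0 1 2 (by simp) (by simp),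
    CategoryTheory.ShortComplex.moduleCat_exact_iff]
  intro (f : P.complex.X 1 ⟶ N) hf
  have hf' : CategoryTheory.CategoryStruct.comp (P.complex.d 2 1) f = 0 := hf
  have hproj : Module.Projective A (P.complex.X 0) :=
    (IsProjective.iff_projective _).2 (P.projective 0)
  have hepi : CategoryTheory.Epi (P.π.f 0) := inferInstance
  have hex0 := (CategoryTheory.ShortComplex.moduleCat_exact_iff _).1 P.exact₀
  have hex1 := (CategoryTheory.ShortComplex.moduleCat_exact_iff _).1 (P.exact_succ 0)
  obtain ⟨h, hh⟩ := H (P.complex.X 1) (P.complex.X 0) (P.complex.d 1 0).hom (P.π.f 0).hom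
    ((ModuleCat.epi_iff_surjective _).1 hepi)
    (fun x => ⟨fun hx => hex0 x hx, by
      rintro ⟨z, rfl⟩
      exact congrArg (fun g => g.hom z) P.complex_d_comp_π_f_zero⟩)
    f.hom
    (fun x hx => by
      obtain ⟨z, hz⟩ := hex1 x hx
      rw [← hz]
      exact congrArg (fun g => g.hom z) hf')
  exact ⟨ModuleCat.ofHom h, ModuleCat.hom_ext hh⟩

open CategoryTheory in
/-- Lemma `lemma_pour_ko_2`: for a dévissage setup `(R,r)` and `n ≥ k ≥ 1`, if
`N` is a finitely generated projective `R/rⁿR`-module and `M` a finitely generated projective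
`R/rᵏR`-module (viewed as `R/rⁿR`-module through the quotient map), then
`Ext¹_{R/rⁿR}(M, N) = 0`. -/
theorem ext_one_vanishing {R : Type u} [CommRing R] (r : R) (hR : IsDevissageSetup R r)
    (n k : ℕ) (hk : 1 ≤ k) (hkn : k ≤ n)
    (M : Type u) [AddCommGroup M] [Module R M]
    (hMk : Module.IsTorsionBySet R M ((Ideal.span {r ^ k} : Ideal R) : Set R))
    (hMn : Module.IsTorsionBySet R M ((Ideal.span {r ^ n} : Ideal R) : Set R))
    (hMfin : letI := hMk.module; Module.Finite (R ⧸ (Ideal.span {r ^ k} : Ideal R)) M)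
    (hMproj : letI := hMk.module; Module.Projective (R ⧸ (Ideal.span {r ^ k} : Ideal R)) M)
    (N : Type u) [AddCommGroup N] [Module R N]
    (hN : Module.IsTorsionBySet R N ((Ideal.span {r ^ n} : Ideal R) : Set R))
    (hNfin : letI := hN.module; Module.Finite (R ⧸ (Ideal.span {r ^ n} : Ideal R)) N)
    (hNproj : letI := hN.module; Module.Projective (R ⧸ (Ideal.span {r ^ n} : Ideal R)) N) :
    letI := hMn.module
    letI := hN.module
    Limits.IsZero
      ((((Ext (R ⧸ (Ideal.span {r ^ n} : Ideal R))
            (ModuleCat.{u} (R ⧸ (Ideal.span {r ^ n} : Ideal R))) 1).obj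
          (Opposite.op (ModuleCat.of _ M))).obj (ModuleCat.of _ N)) : ModuleCat _) := by
  let i1 := hMn.module
  let i2 := hN.module
  let i3 := hMk.module
  have : IsScalarTower R (R ⧸ (Ideal.span {r ^ n} : Ideal R)) M := hMn.isScalarTower
  have : IsScalarTower R (R ⧸ (Ideal.span {r ^ k} : Ideal R)) M := hMk.isScalarTower
  have := hMfin
  have := hMproj
  have := hNproj
  have hle : (Ideal.span {r ^ n} : Ideal R) ≤ Ideal.span {r ^ k} :=
    Ideal.span_singleton_le_span_singleton.2 (pow_dvd_pow r hkn)
  have hcancel : ∀ (j : ℕ) (x : R), r ^ j * x = 0 → x = 0 := by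
    intro j
    induction j with
    | zero => intro x hx; simpa using hx
    | succ j ih =>
      intro x hx
      rw [pow_succ, mul_assoc] at hx
      exact hR.torsionFree _ (ih _ hx)
  have hnk : r ^ n = r ^ (n - k) * r ^ k := by rw [← pow_add, Nat.sub_add_cancel hkn]
  obtain ⟨m, p, s, hs⟩ := retract_data (Ideal.span {r ^ k}) M (Ideal.span {r ^ n}) hle
    (Ideal.Quotient.mk _ (r ^ k)) (by
      intro x
      constructor
      · intro hx
        obtain ⟨y, hy⟩ := Ideal.mem_span_singleton.1 hx
        obtain ⟨y, rfl⟩ := Ideal.Quotient.mk_surjective y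
        rw [← map_mul, Ideal.Quotient.eq] at hy
        have := Ideal.add_mem _ (hle hy)
          (Ideal.mul_mem_right y _ (Ideal.mem_span_singleton_self (r ^ k)))
        simpa using this
      · intro hx
        obtain ⟨y, rfl⟩ := Ideal.mem_span_singleton.1 hx
        rw [map_mul]
        exact Ideal.mul_mem_right _ _ (Ideal.mem_span_singleton_self _))
  refine ext_zero_of_core _ _ _ ?_
  intro P₁ P₀ _ d π hπ hex f hf
  refine ext_core (Ideal.Quotient.mk _ (r ^ k)) (Ideal.Quotient.mk _ (r ^ (n - k))) ?_ ?_
    m p s hs d π hπ hex f hf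
  · rw [← map_mul, ← hnk]
    exact Ideal.Quotient.eq_zero_iff_mem.2 (Ideal.mem_span_singleton_self _)
  · refine proj_tors (N := N) _ _ ?_
    intro x hx
    obtain ⟨x, rfl⟩ := Ideal.Quotient.mk_surjective x
    rw [← map_mul, Ideal.Quotient.eq_zero_iff_mem] at hx
    obtain ⟨y, hy⟩ := Ideal.mem_span_singleton.1 hx
    refine ⟨Ideal.Quotient.mk _ y, ?_⟩
    rw [← map_mul]
    congr 1
    rw [← sub_eq_zero]
    apply hcancel (n - k)
    rw [mul_sub, hy, hnk]
    ring
end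

section
/- Let (R, r) be a dévissage setup and let M and N be finitely presented R-modules, each with finite projective (r,μ)-dévissage and bounded r^∞-torsion. Then the R-module M ⊗_R N is finitely presented, has finite projective (r,μ)-dévissage, and has bounded r^∞-torsion; moreover, for every n ≥ 0 there is an isomorphism of R/rR-modules rⁿ(M ⊗_R N)/rⁿ⁺¹(M ⊗_R N) ≅ (rⁿM/rⁿ⁺¹M) ⊗_{R/rR} (rⁿN/rⁿ⁺¹N). -/
open Pointwise

universe u

theorem dv_ext {R : Type u} [CommRing R] (r : R) {L L' P B : Type u}
    [AddCommGroup L] [Module R L] [AddCommGroup L'] [Module R L'] [AddCommGroup B] [Module R B]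
    [AddCommGroup P] [Module R P] [Module (R ⧸ (Ideal.span {r} : Ideal R)) P]
    [IsScalarTower R (R ⧸ (Ideal.span {r} : Ideal R)) P]
    (hP : Module.Projective (R ⧸ (Ideal.span {r} : Ideal R)) P)
    (p : L →ₗ[R] P) (hp : Function.Surjective p)
    (ι : L' →ₗ[R] L) (hι : Function.Injective ι) (hr : ∀ x, p x = 0 ↔ ∃ y, ι y = x)
    (h : L' →ₗ[R] B) (hdiv : ∀ x y, ι y = r • x → ∃ b, h y = r • b) :
    ∃ h' : L →ₗ[R] B, ∀ y, h' (ι y) = h y := by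
  classical
  have hrP : ∀ x : P, r • x = 0 := by
    intro x
    rw [← algebraMap_smul (R ⧸ (Ideal.span {r} : Ideal R)) r x]
    have : algebraMap R (R ⧸ (Ideal.span {r} : Ideal R)) r = 0 :=
      Ideal.Quotient.eq_zero_iff_mem.mpr (Ideal.mem_span_singleton_self r)
    rw [this, zero_smul]
  obtain ⟨σ, hσ⟩ := hP.out
  let A := R ⧸ (Ideal.span {r} : Ideal R)
  let red : (P →₀ R) →ₗ[R] (P →₀ A) := Finsupp.mapRange.linearMap (Algebra.linearMap R A)
  have hred : Function.Surjective red := by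
    apply Finsupp.mapRange_surjective _ (map_zero _)
    exact Ideal.Quotient.mk_surjective (I := Ideal.span {r})
  have hredker : ∀ a, red a = 0 → ∃ c, a = r • c := by
    intro a ha
    have h1 : ∀ i, ∃ c, a i = r * c := by
      intro i
      have := DFunLike.congr_fun ha i
      have h2 : (Ideal.Quotient.mk (Ideal.span {r}) (a i)) = 0 := this
      rw [Ideal.Quotient.eq_zero_iff_mem, Ideal.mem_span_singleton] at h2
      exact h2
    choose c hc using h1
    refine ⟨Finsupp.onFinset a.support (fun i => if a i = 0 then 0 else c i) ?_, ?_⟩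
    · intro i hi
      by_contra hcon
      simp at hcon
      simp [hcon] at hi
    · ext i
      by_cases h0 : a i = 0
      · simp [h0]
      · simp [h0, ← hc]
  let π : (P →₀ R) →ₗ[R] P := Finsupp.linearCombination R id
  let πA : (P →₀ A) →ₗ[A] P := Finsupp.linearCombination A id
  have hπ : ∀ a, π a = πA (red a) := by
    intro a
    have : π = (πA.restrictScalars R) ∘ₗ red := by
      apply Finsupp.lhom_ext'
      intro i
      ext
      simp [π, πA, red]
    rw [this]; rfl
  obtain ⟨s, hs⟩ := Module.projective_lifting_property p π hp
  obtain ⟨e, he⟩ := Module.projective_lifting_property red ((σ.restrictScalars R) ∘ₗ π) hred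
  have hs' : ∀ a, p (s a) = π a := fun a => LinearMap.congr_fun hs a
  have he' : ∀ a, red (e a) = σ (π a) := fun a => LinearMap.congr_fun he a
  have hπe : ∀ a, π (e a) = π a := by
    intro a
    rw [hπ (e a), he']; exact hσ _
  -- lifting along the injection
  let E := LinearEquiv.ofInjective ι hι
  have lift : ∀ f : (P →₀ R) →ₗ[R] L, (∀ a, p (f a) = 0) →
      ∃ g : (P →₀ R) →ₗ[R] L', ∀ a, ι (g a) = f a := by
    intro f hf
    refine ⟨E.symm.toLinearMap ∘ₗ f.codRestrict (LinearMap.range ι) (fun a => (hr _).1 (hf a)), ?_⟩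
    intro a
    have := E.apply_symm_apply (f.codRestrict (LinearMap.range ι) (fun a => (hr _).1 (hf a)) a)
    exact congrArg Subtype.val this
  obtain ⟨k, hk⟩ := lift (s ∘ₗ (LinearMap.id - e)) (by intro a; simp [hs', hπe])
  obtain ⟨m, hm⟩ := lift (r • s) (by intro a; simp [hrP])
  have hmdiv : ∀ a, ∃ b, h (m a) = r • b := fun a => hdiv (s a) (m a) (by rw [hm]; rfl)
  choose tb htb using fun i : P => hmdiv (Finsupp.single i 1)
  let t : (P →₀ R) →ₗ[R] B := Finsupp.linearCombination R tb
  have ht : ∀ c, r • t c = h (m c) := by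
    intro c
    have : r • t = h ∘ₗ m := by
      apply Finsupp.lhom_ext'
      intro i
      ext
      simp [t, htb]
    exact LinearMap.congr_fun this c
  let b := h ∘ₗ k + t ∘ₗ e
  let ψ : (L' × (P →₀ R)) →ₗ[R] L := LinearMap.coprod ι s
  let χ : (L' × (P →₀ R)) →ₗ[R] B := LinearMap.coprod h b
  have hψ : Function.Surjective ψ := by
    intro x
    have hx : p (x - s (Finsupp.single (p x) 1)) = 0 := by simp [hs', π]
    obtain ⟨y, hy⟩ := (hr _).1 hx
    exact ⟨(y, Finsupp.single (p x) 1), by simp [ψ, hy]⟩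
  have hker : LinearMap.ker ψ ≤ LinearMap.ker χ := by
    rintro ⟨y, a⟩ hya
    have hya : ι y + s a = 0 := by simpa [ψ] using hya
    have hpa : π a = 0 := by
      rw [← hs', eq_neg_of_add_eq_zero_right hya, map_neg, (hr _).2 ⟨y, rfl⟩, neg_zero]
    obtain ⟨c, hc⟩ := hredker (e a) (by rw [he', hpa, map_zero])
    have h1 : y + k a + m c = 0 := by
      apply hι
      rw [map_add, map_add, hk, hm, map_zero]
      have : r • s c = s (e a) := by rw [hc, map_smul]
      simp only [LinearMap.comp_apply, LinearMap.sub_apply, LinearMap.id_apply, LinearMap.smul_apply,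
        this, map_sub]
      rw [← hya]; abel
    have : h y + (h (k a) + t (e a)) = 0 := by
      rw [hc, map_smul, ht, ← map_add, ← map_add, ← add_assoc, h1, map_zero]
    simpa [χ, b] using this
  refine ⟨(LinearMap.ker ψ).liftQ χ hker ∘ₗ (ψ.quotKerEquivOfSurjective hψ).symm.toLinearMap, ?_⟩
  intro y
  have : (ψ.quotKerEquivOfSurjective hψ).symm (ι y) = Submodule.Quotient.mk (y, 0) := by
    rw [LinearEquiv.symm_apply_eq]
    simp [ψ]
  simp only [LinearMap.comp_apply, LinearEquiv.coe_coe, this]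
  simp [χ]

theorem dv_detect {A : Type u} [CommRing A] {P Q : Type u} [AddCommGroup P] [Module A P]
    [AddCommGroup Q] [Module A Q] (hP : Module.Projective A P) (hQ : Module.Projective A Q)
    (z : TensorProduct A P Q)
    (hz : ∀ (f : P →ₗ[A] A) (g : Q →ₗ[A] A), LinearMap.mul' A A (TensorProduct.map f g z) = 0) :
    z = 0 := by
  obtain ⟨σ, hσ⟩ := hP.out
  obtain ⟨τ, hτ⟩ := hQ.out
  have hinj : Function.LeftInverse (TensorProduct.map (Finsupp.linearCombination A (id : P → P))
      (Finsupp.linearCombination A (id : Q → Q))) (TensorProduct.map σ τ) := by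
    intro x
    rw [← LinearMap.comp_apply, ← TensorProduct.map_comp]
    have h1 : (Finsupp.linearCombination A (id : P → P)) ∘ₗ σ = LinearMap.id := LinearMap.ext hσ
    have h2 : (Finsupp.linearCombination A (id : Q → Q)) ∘ₗ τ = LinearMap.id := LinearMap.ext hτ
    rw [h1, h2, TensorProduct.map_id]; rfl
  apply hinj.injective
  rw [map_zero]
  apply (finsuppTensorFinsupp' A P Q).injective
  rw [map_zero]
  ext ⟨i, j⟩
  have := hz (Finsupp.lapply i ∘ₗ σ) (Finsupp.lapply j ∘ₗ τ)
  rw [Finsupp.zero_apply, ← this]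
  clear this hz
  induction z with
  | zero => simp
  | tmul x y => simp
  | add x y hx hy => simp only [map_add, Finsupp.add_apply, hx, hy]

theorem dv_fp {R : Type u} [CommRing R] {M N : Type u} [AddCommGroup M] [Module R M]
    [AddCommGroup N] [Module R N] (hM : Module.FinitePresentation R M)
    (hN : Module.FinitePresentation R N) : Module.FinitePresentation R (TensorProduct R M N) := by
  obtain ⟨n, f, hf⟩ := Module.Finite.exists_fin' R M
  have hk : (LinearMap.ker f).FG := Module.FinitePresentation.fg_ker f hf
  have : Module.Finite R (LinearMap.ker f) := Module.Finite.iff_fg.mpr hk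
  have e : TensorProduct R (Fin n → R) N ≃ₗ[R] (Fin n → N) :=
    (TensorProduct.comm R _ _).trans (TensorProduct.piScalarRight R R N (Fin n))
  have : Module.FinitePresentation R (TensorProduct R (Fin n → R) N) := .of_equiv e.symm
  refine Module.finitePresentation_of_surjective (f.rTensor N) (LinearMap.rTensor_surjective N hf) ?_
  rw [(rTensor_exact N (LinearMap.exact_subtype_ker_map f) hf).linearMap_ker_eq]
  rw [LinearMap.range_eq_map]
  exact Submodule.FG.map _ (Module.Finite.fg_top)

theorem dv_sep {R : Type u} [CommRing R] (r : R) (hR : IsAdicComplete (Ideal.span {r}) R)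
    {T : Type u} [AddCommGroup T] [Module R T] (hT : Module.FinitePresentation R T)
    (y : ℕ → T) (hy : ∀ i, y i = r • y (i + 1)) : y 0 = 0 := by
  have hmem : ∀ n (x : R), x ∈ ((Ideal.span {r}) ^ n • ⊤ : Submodule R R) ↔ r ^ n ∣ x := by
    intro n x
    rw [Ideal.span_singleton_pow, smul_eq_mul, Ideal.mul_top, Ideal.mem_span_singleton]
  have haus : ∀ x : R, (∀ n : ℕ, r ^ n ∣ x) → x = 0 := by
    intro x hx
    apply hR.haus'
    intro n
    rw [SModEq.zero, hmem]
    exact hx n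
  have hsum : ∀ a : ℕ → R, ∃ α : R, ∀ n, r ^ n ∣ (∑ j ∈ Finset.range n, r ^ j * a j) - α := by
    intro a
    obtain ⟨α, hα⟩ := hR.prec' (fun n => ∑ j ∈ Finset.range n, r ^ j * a j) (by
      intro m n hmn
      rw [SModEq.comm, SModEq.sub_mem, hmem, Finset.sum_range_sub_sum_range hmn]
      apply Finset.dvd_sum
      intro j hj
      simp at hj
      exact (pow_dvd_pow r (by omega)).mul_right _)
    refine ⟨α, fun n => ?_⟩
    have := hα n
    rwa [SModEq.sub_mem, hmem] at this
  have htel : ∀ a : ℕ → R, ∃ α : ℕ → R, ∀ i, a i = α i - r * α (i + 1) := by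
    intro a
    choose α hα using fun i => hsum (fun j => a (i + j))
    refine ⟨α, fun i => ?_⟩
    rw [← sub_eq_zero]
    apply haus
    intro n
    have h1 := hα i (n + 1)
    have h2 := hα (i + 1) n
    rw [Finset.sum_range_succ'] at h1
    have h3 : ∑ k ∈ Finset.range n, r ^ (k + 1) * a (i + (k + 1)) =
        r * ∑ k ∈ Finset.range n, r ^ k * a (i + 1 + k) := by
      rw [Finset.mul_sum]
      refine Finset.sum_congr rfl fun k _ => ?_
      rw [show i + (k + 1) = i + 1 + k by ring]; ring
    rw [h3] at h1
    have h4 := dvd_sub ((pow_dvd_pow r (Nat.le_succ n)).trans h1) (h2.mul_left r)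
    convert h4 using 1
    simp; ring
  obtain ⟨n, f, hf⟩ := Module.Finite.exists_fin' R T
  have hk : (LinearMap.ker f).FG := Module.FinitePresentation.fg_ker f hf
  have : Module.Finite R (LinearMap.ker f) := Module.Finite.iff_fg.mpr hk
  obtain ⟨m, g, hg⟩ := Module.Finite.exists_fin' R (LinearMap.ker f)
  choose Y hY using fun i => hf (y i)
  have hker : ∀ i, Y i - r • Y (i + 1) ∈ LinearMap.ker f := by
    intro i
    rw [LinearMap.mem_ker, map_sub, map_smul, hY, hY, ← hy, sub_self]
  choose a ha using fun i => hg ⟨_, hker i⟩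
  choose α hα using fun j : Fin m => htel (fun i => a i j)
  let β : ℕ → Fin m → R := fun i j => α j i
  have hβ : ∀ i, a i = β i - r • β (i + 1) := by
    intro i; ext j; simpa [β] using hα j i
  let U : ℕ → Fin n → R := fun i => Y i - (g (β i) : Fin n → R)
  have hU : ∀ i, U i = r • U (i + 1) := by
    intro i
    have h1 : (g (a i) : Fin n → R) = Y i - r • Y (i + 1) := by rw [ha]
    rw [hβ, map_sub, map_smul] at h1
    simp only [U, smul_sub]
    have h2 : (g (β i) : Fin n → R) - r • (g (β (i + 1)) : Fin n → R) = Y i - r • Y (i + 1) := h1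
    rw [sub_eq_sub_iff_add_eq_add] at h2 ⊢
    rw [← h2, add_comm]
  have hU' : ∀ k i, U i = r ^ k • U (i + k) := by
    intro k
    induction k with
    | zero => simp
    | succ k ih => intro i; rw [ih i, hU (i + k), smul_smul, pow_succ, add_assoc]
  have hU0 : U 0 = 0 := by
    ext j
    apply haus
    intro k
    rw [hU' k 0]
    exact Dvd.intro _ rfl
  have : Y 0 = (g (β 0) : Fin n → R) := sub_eq_zero.mp hU0
  rw [← hY, this]
  exact (g (β 0)).2

section DvMain

variable {R : Type u} [CommRing R] (r : R) (M : Type u) [AddCommGroup M] [Module R M]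

noncomputable local instance dvModule (n : ℕ) :
    Module (R ⧸ (Ideal.span {r} : Ideal R)) (muQuotSub r M n) :=
  (muQuotSub_isTorsionBySet r M n).module

theorem dvTower (n : ℕ) : IsScalarTower R (R ⧸ (Ideal.span {r} : Ideal R)) (muQuotSub r M n) :=
  (muQuotSub_isTorsionBySet r M n).isScalarTower

attribute [local instance] dvTower

/-- the projection `rⁿM → rⁿM/rⁿ⁺¹M` -/
noncomputable def dvP (n : ℕ) : ↥(r ^ n • (⊤ : Submodule R M)) →ₗ[R] muQuotSub r M n :=
  (r ^ (n + 1) • (⊤ : Submodule R M)).mkQ.submoduleMap (r ^ n • (⊤ : Submodule R M))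

theorem dvP_surj (n : ℕ) : Function.Surjective (dvP r M n) :=
  LinearMap.submoduleMap_surjective _ _

variable {M}

theorem dv_mem (n : ℕ) (x : M) : x ∈ r ^ n • (⊤ : Submodule R M) ↔ ∃ y, x = r ^ n • y := by
  rw [Submodule.mem_smul_pointwise_iff_exists]
  constructor
  · rintro ⟨y, -, rfl⟩; exact ⟨y, rfl⟩
  · rintro ⟨y, rfl⟩; exact ⟨y, Submodule.mem_top, rfl⟩

theorem dvP_eq_zero (n : ℕ) (x : ↥(r ^ n • (⊤ : Submodule R M))) :
    dvP r M n x = 0 ↔ x.1 ∈ r ^ (n + 1) • (⊤ : Submodule R M) := by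
  rw [← Submodule.Quotient.mk_eq_zero, ← Subtype.val_inj]
  rfl

variable (M)

/-- multiplication by `rⁿ` onto `rⁿM` -/
noncomputable def dvS (n : ℕ) : M →ₗ[R] ↥(r ^ n • (⊤ : Submodule R M)) :=
  (r ^ n • LinearMap.id : M →ₗ[R] M).codRestrict _ (fun x => (dv_mem r n _).2 ⟨x, rfl⟩)

theorem dvS_coe (n : ℕ) (x : M) : (dvS r M n x : M) = r ^ n • x := rfl

theorem dvS_surj (n : ℕ) : Function.Surjective (dvS r M n) := by
  rintro ⟨x, hx⟩
  obtain ⟨y, rfl⟩ := (dv_mem r n _).1 hx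
  exact ⟨y, rfl⟩

/-- the map `M → rⁿM/rⁿ⁺¹M`, `x ↦ [rⁿ x]` -/
noncomputable def dvQ (n : ℕ) : M →ₗ[R] muQuotSub r M n := dvP r M n ∘ₗ dvS r M n

theorem dvQ_surj (n : ℕ) : Function.Surjective (dvQ r M n) :=
  (dvP_surj r M n).comp (dvS_surj r M n)

variable {M}

theorem dvQ_eq_zero (n : ℕ) (x : M) :
    dvQ r M n x = 0 ↔ ∃ y, r ^ n • x = r ^ (n + 1) • y := by
  rw [← dv_mem]
  exact dvP_eq_zero r n _

theorem dv_incl_le {m n : ℕ} (h : m ≤ n) :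
    r ^ n • (⊤ : Submodule R M) ≤ r ^ m • (⊤ : Submodule R M) := by
  intro x hx
  obtain ⟨y, rfl⟩ := (dv_mem r n _).1 hx
  obtain ⟨k, rfl⟩ := Nat.exists_eq_add_of_le h
  exact (dv_mem r m _).2 ⟨r ^ k • y, by rw [smul_smul, pow_add]⟩

variable {r}

theorem dv_cancel (hR : ∀ x : R, r * x = 0 → x = 0) (n : ℕ) (x : R)
    (h : r ^ (n + 1) ∣ r ^ n * x) : r ∣ x := by
  induction n with
  | zero => simpa using h
  | succ n ih =>
    apply ih
    obtain ⟨c, hc⟩ := h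
    refine ⟨c, sub_eq_zero.mp (hR _ ?_)⟩
    rw [mul_sub, sub_eq_zero, ← mul_assoc, ← mul_assoc, ← pow_succ', ← pow_succ', hc]

theorem dv_extend (hR : ∀ x : R, r * x = 0 → x = 0)
    (hM : ∀ n, Module.Projective (R ⧸ (Ideal.span {r} : Ideal R)) (muQuotSub r M n))
    (n k : ℕ) (hk : k ≤ n)
    (h : ↥(r ^ k • (⊤ : Submodule R M)) →ₗ[R] (R ⧸ (Ideal.span {r ^ (n + 1)} : Ideal R)))
    (hh : ∀ x : ↥(r ^ k • (⊤ : Submodule R M)), x.1 ∈ r ^ (n + 1) • (⊤ : Submodule R M) → h x = 0) :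
    ∃ G : M →ₗ[R] (R ⧸ (Ideal.span {r ^ (n + 1)} : Ideal R)),
      ∀ x : ↥(r ^ k • (⊤ : Submodule R M)), G x.1 = h x := by
  induction k with
  | zero =>
    refine ⟨h ∘ₗ dvS r M 0, fun x => ?_⟩
    rw [LinearMap.comp_apply]
    congr 1
    apply Subtype.ext
    rw [dvS_coe]
    exact (congrArg (fun a : R => a • (x : M)) (pow_zero r)).trans (one_smul R _)
  | succ k ih =>
    obtain ⟨h', hh'⟩ := dv_ext r (hM k) (dvP r M k) (dvP_surj r M k)
      (Submodule.inclusion (dv_incl_le r (Nat.le_succ k)))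
      (Submodule.inclusion_injective _) (by
        intro x
        rw [dvP_eq_zero]
        constructor
        · intro hx; exact ⟨⟨x.1, hx⟩, rfl⟩
        · rintro ⟨y, rfl⟩; exact y.2) h (by
        rintro ⟨x, hx⟩ y hy
        have hy' : (y : M) = r • x := congrArg Subtype.val hy
        have h0 : r ^ n • h y = 0 := by
          rw [← map_smul]
          apply hh
          rw [dv_mem]
          refine ⟨x, ?_⟩
          rw [Submodule.coe_smul, hy', smul_smul, pow_succ]
        obtain ⟨b, hb⟩ := Ideal.Quotient.mk_surjective (h y)
        rw [← hb] at h0 ⊢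
        have h1 : Ideal.Quotient.mk (Ideal.span {r ^ (n + 1)}) (r ^ n * b) = 0 := h0
        rw [Ideal.Quotient.eq_zero_iff_mem, Ideal.mem_span_singleton] at h1
        obtain ⟨c, rfl⟩ := dv_cancel hR n b h1
        exact ⟨Ideal.Quotient.mk _ c, rfl⟩)
    obtain ⟨G, hG⟩ := ih (by omega) h' (by
      intro x hx
      have hx' := dv_incl_le (M := M) r (show k + 1 ≤ n + 1 by omega) hx
      have := hh' ⟨x.1, hx'⟩
      rw [hh _ hx] at this
      exact this)
    refine ⟨G, fun x => ?_⟩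
    rw [← hh' x, ← hG]; rfl

theorem dv_functional (hR : ∀ x : R, r * x = 0 → x = 0)
    (hM : ∀ n, Module.Projective (R ⧸ (Ideal.span {r} : Ideal R)) (muQuotSub r M n))
    (n : ℕ) (f : muQuotSub r M n →ₗ[R ⧸ (Ideal.span {r} : Ideal R)] R ⧸ (Ideal.span {r} : Ideal R)) :
    ∃ G : M →ₗ[R] (R ⧸ (Ideal.span {r ^ (n + 1)} : Ideal R)), ∀ (x : M) (b : R),
      G x = Ideal.Quotient.mk _ b → f (dvQ r M n x) = Ideal.Quotient.mk _ b := by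
  let μ : (R ⧸ (Ideal.span {r} : Ideal R)) →ₗ[R] (R ⧸ (Ideal.span {r ^ (n + 1)} : Ideal R)) :=
    Submodule.mapQ _ _ (r ^ n • LinearMap.id : R →ₗ[R] R) (by
      intro x hx
      rw [Ideal.mem_span_singleton] at hx
      obtain ⟨c, rfl⟩ := hx
      rw [Submodule.mem_comap, Ideal.mem_span_singleton]
      exact ⟨c, by simp [pow_succ, mul_assoc]⟩)
  have hμ : ∀ a : R, μ (Ideal.Quotient.mk _ a) = Ideal.Quotient.mk _ (r ^ n * a) := fun a => rfl
  obtain ⟨G, hG⟩ := dv_extend hR hM n n le_rfl (μ ∘ₗ (f.restrictScalars R) ∘ₗ dvP r M n) (by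
    intro x hx
    have := (dvP_eq_zero r n x).2 hx
    simp [this])
  refine ⟨G, fun x b hb => ?_⟩
  have h1 := hG (dvS r M n x)
  rw [dvS_coe, map_smul, hb] at h1
  obtain ⟨a, ha⟩ := Ideal.Quotient.mk_surjective (f (dvQ r M n x))
  have h2 : Ideal.Quotient.mk (Ideal.span {r ^ (n + 1)}) (r ^ n * b) =
      μ (f (dvQ r M n x)) := h1
  rw [← ha, hμ, Ideal.Quotient.eq, Ideal.mem_span_singleton, ← mul_sub] at h2
  rw [← ha, eq_comm, Ideal.Quotient.eq, Ideal.mem_span_singleton]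
  exact dv_cancel hR n _ h2

variable (r M) (N : Type u) [AddCommGroup N] [Module R N]

theorem dvCompat (m n : ℕ) : TensorProduct.CompatibleSMul R (R ⧸ (Ideal.span {r} : Ideal R))
    (muQuotSub r M m) (muQuotSub r N n) where
  smul_tmul a x y := by
    obtain ⟨a, rfl⟩ := Ideal.Quotient.mk_surjective a
    exact TensorProduct.smul_tmul a x y

attribute [local instance] dvCompat

/-- the canonical map `M ⊗ N → Mₙ ⊗ Nₙ` -/
noncomputable def dvPhi (n : ℕ) : TensorProduct R M N →ₗ[R]
    TensorProduct (R ⧸ (Ideal.span {r} : Ideal R)) (muQuotSub r M n) (muQuotSub r N n) :=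
  (TensorProduct.equivOfCompatibleSMul R (R ⧸ (Ideal.span {r} : Ideal R)) R
    (muQuotSub r M n) (muQuotSub r N n)).symm.toLinearMap ∘ₗ
      TensorProduct.map (dvQ r M n) (dvQ r N n)

theorem dvPhi_tmul (n : ℕ) (x : M) (y : N) :
    dvPhi r M N n (TensorProduct.tmul R x y) = TensorProduct.tmul _ (dvQ r M n x) (dvQ r N n y) :=
  rfl

theorem dvPhi_surj (n : ℕ) : Function.Surjective (dvPhi r M N n) := by
  refine (LinearEquiv.surjective (TensorProduct.equivOfCompatibleSMul R
    (R ⧸ (Ideal.span {r} : Ideal R)) R (muQuotSub r M n) (muQuotSub r N n)).symm).comp ?_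
  exact TensorProduct.map_surjective (dvQ_surj r M n) (dvQ_surj r N n)

variable {r M N}

theorem dvPhi_ker1 (n : ℕ) (z : TensorProduct R M N) (hz : dvPhi r M N n z = 0) :
    ∃ w, r ^ n • z = r ^ (n + 1) • w := by
  have h1 : z ∈ LinearMap.ker (TensorProduct.map (dvQ r M n) (dvQ r N n)) := by
    have := (LinearEquiv.map_eq_zero_iff (TensorProduct.equivOfCompatibleSMul R
      (R ⧸ (Ideal.span {r} : Ideal R)) R (muQuotSub r M n) (muQuotSub r N n)).symm).1 hz
    exact this
  rw [TensorProduct.map_ker (LinearMap.exact_subtype_ker_map (dvQ r M n)) (dvQ_surj r M n)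
    (LinearMap.exact_subtype_ker_map (dvQ r N n)) (dvQ_surj r N n)] at h1
  rw [← dv_mem, ← dvS_coe, ← dvP_eq_zero, ← LinearMap.comp_apply, ← LinearMap.mem_ker]
  revert z
  intro z _ h1
  refine (sup_le ?_ ?_ : _ ≤ LinearMap.ker (dvP r (TensorProduct R M N) n ∘ₗ
    dvS r (TensorProduct R M N) n)) h1
  · rw [LinearMap.range_le_ker_iff]
    apply TensorProduct.ext'
    rintro x ⟨y, hy⟩
    obtain ⟨y', hy'⟩ := (dvQ_eq_zero r n y).1 hy
    refine (dvQ_eq_zero r n _).2 ⟨TensorProduct.tmul R x y', ?_⟩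
    simp only [LinearMap.lTensor_tmul, Submodule.subtype_apply]
    rw [← TensorProduct.tmul_smul, ← TensorProduct.tmul_smul, hy']
  · rw [LinearMap.range_le_ker_iff]
    apply TensorProduct.ext'
    rintro ⟨y, hy⟩ x
    obtain ⟨y', hy'⟩ := (dvQ_eq_zero r n y).1 hy
    refine (dvQ_eq_zero r n _).2 ⟨TensorProduct.tmul R y' x, ?_⟩
    simp only [LinearMap.rTensor_tmul, Submodule.subtype_apply]
    rw [TensorProduct.smul_tmul', TensorProduct.smul_tmul', hy']

theorem dvPhi_ker2 (hR : ∀ x : R, r * x = 0 → x = 0)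
    (hM : ∀ n, Module.Projective (R ⧸ (Ideal.span {r} : Ideal R)) (muQuotSub r M n))
    (hN : ∀ n, Module.Projective (R ⧸ (Ideal.span {r} : Ideal R)) (muQuotSub r N n))
    (n : ℕ) (z w : TensorProduct R M N) (hz : r ^ n • z = r ^ (n + 1) • w) :
    dvPhi r M N n z = 0 := by
  apply dv_detect (hM n) (hN n)
  intro f g
  obtain ⟨F, hF⟩ := dv_functional hR hM n f
  obtain ⟨G, hG⟩ := dv_functional hR hN n g
  let T : TensorProduct R M N →ₗ[R] (R ⧸ (Ideal.span {r ^ (n + 1)} : Ideal R)) :=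
    LinearMap.mul' R _ ∘ₗ TensorProduct.map F G
  have key : ∀ (u : TensorProduct R M N) , ∃ b : R, T u = Ideal.Quotient.mk _ b ∧
      LinearMap.mul' _ _ (TensorProduct.map f g (dvPhi r M N n u)) = Ideal.Quotient.mk _ b := by
    intro u
    induction u with
    | zero => exact ⟨0, by simp, by simp⟩
    | tmul x y =>
      obtain ⟨a, ha⟩ := Ideal.Quotient.mk_surjective (F x)
      obtain ⟨b, hb⟩ := Ideal.Quotient.mk_surjective (G y)
      refine ⟨a * b, ?_, ?_⟩
      · simp [T, ha, hb]
      · rw [dvPhi_tmul, TensorProduct.map_tmul, LinearMap.mul'_apply, hF x a ha.symm,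
          hG y b hb.symm, map_mul]
    | add u v hu hv =>
      obtain ⟨a, ha, ha'⟩ := hu
      obtain ⟨b, hb, hb'⟩ := hv
      exact ⟨a + b, by rw [map_add, map_add, ha, hb], by
        rw [map_add, map_add, map_add, map_add, ha', hb']⟩
  obtain ⟨b, hb, hb'⟩ := key z
  rw [hb', Ideal.Quotient.eq_zero_iff_mem, Ideal.mem_span_singleton]
  apply dv_cancel hR n
  have h1 : r ^ n • T z = r ^ (n + 1) • T w := by rw [← map_smul, hz, map_smul]
  obtain ⟨c, hc⟩ := Ideal.Quotient.mk_surjective (T w)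
  rw [hb, ← hc] at h1
  have h2 : Ideal.Quotient.mk (Ideal.span {r ^ (n + 1)}) (r ^ n * b) =
    Ideal.Quotient.mk _ (r ^ (n + 1) * c) := h1
  rw [Ideal.Quotient.eq, Ideal.mem_span_singleton] at h2
  exact (dvd_sub_left (Dvd.intro _ rfl)).1 h2

theorem dv_iso (hR : ∀ x : R, r * x = 0 → x = 0)
    (hM : ∀ n, Module.Projective (R ⧸ (Ideal.span {r} : Ideal R)) (muQuotSub r M n))
    (hN : ∀ n, Module.Projective (R ⧸ (Ideal.span {r} : Ideal R)) (muQuotSub r N n)) (n : ℕ) :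
    Nonempty ((muQuotSub r (TensorProduct R M N) n) ≃ₗ[R ⧸ (Ideal.span {r} : Ideal R)]
        (TensorProduct (R ⧸ (Ideal.span {r} : Ideal R)) (muQuotSub r M n) (muQuotSub r N n))) := by
  have hk : LinearMap.ker (dvQ r (TensorProduct R M N) n) = LinearMap.ker (dvPhi r M N n) := by
    ext z
    rw [LinearMap.mem_ker, LinearMap.mem_ker, dvQ_eq_zero]
    exact ⟨fun ⟨w, hw⟩ => dvPhi_ker2 hR hM hN n z w hw, dvPhi_ker1 n z⟩
  let e := ((dvQ r (TensorProduct R M N) n).quotKerEquivOfSurjective (dvQ_surj r _ n)).symm.trans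
    ((Submodule.quotEquivOfEq _ _ hk).trans
      ((dvPhi r M N n).quotKerEquivOfSurjective (dvPhi_surj r M N n)))
  exact ⟨e.extendScalarsOfSurjective Ideal.Quotient.mk_surjective⟩

theorem dv_transition {K : ℕ} (hK : ∀ x : M, (∃ k : ℕ, r ^ k • x = 0) → r ^ K • x = 0)
    (n j : ℕ) (hn : K ≤ n) :
    ∃ e : muQuotSub r M n ≃ₗ[R ⧸ (Ideal.span {r} : Ideal R)] muQuotSub r M (n + j),
      ∀ x, e (dvQ r M n x) = dvQ r M (n + j) x := by
  have hk : LinearMap.ker (dvQ r M n) = LinearMap.ker (dvQ r M (n + j)) := by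
    ext x
    rw [LinearMap.mem_ker, LinearMap.mem_ker, dvQ_eq_zero, dvQ_eq_zero]
    constructor
    · rintro ⟨y, hy⟩
      refine ⟨y, ?_⟩
      rw [add_comm n j, pow_add, ← smul_smul, hy, smul_smul, ← pow_add]; rfl
    · rintro ⟨y, hy⟩
      refine ⟨y, ?_⟩
      have h1 : r ^ K • (x - r • y) = 0 := by
        apply hK
        refine ⟨n + j, ?_⟩
        rw [smul_sub, hy, smul_smul, ← pow_succ, sub_self]
      obtain ⟨d, rfl⟩ := Nat.exists_eq_add_of_le hn
      have h2 : r ^ (K + d) • (x - r • y) = 0 := by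
        rw [add_comm, pow_add, ← smul_smul, h1, smul_zero]
      rwa [smul_sub, smul_smul, ← pow_succ, sub_eq_zero] at h2
  let e := ((dvQ r M n).quotKerEquivOfSurjective (dvQ_surj r _ n)).symm.trans
    ((Submodule.quotEquivOfEq _ _ hk).trans
      ((dvQ r M (n + j)).quotKerEquivOfSurjective (dvQ_surj r M (n + j))))
  refine ⟨e.extendScalarsOfSurjective Ideal.Quotient.mk_surjective, fun x => ?_⟩
  have h1 : ((dvQ r M n).quotKerEquivOfSurjective (dvQ_surj r _ n)).symm (dvQ r M n x) =
      Submodule.Quotient.mk x := by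
    rw [LinearEquiv.symm_apply_eq]; rfl
  simp only [e, LinearEquiv.extendScalarsOfSurjective_apply, LinearEquiv.trans_apply, h1]
  rfl

theorem dv_bounded (hR : IsDevissageSetup R r)
    (hM : ∀ n, Module.Projective (R ⧸ (Ideal.span {r} : Ideal R)) (muQuotSub r M n))
    (hN : ∀ n, Module.Projective (R ⧸ (Ideal.span {r} : Ideal R)) (muQuotSub r N n))
    (hT : Module.FinitePresentation R (TensorProduct R M N))
    (hMb : BoundedRTorsion r M) (hNb : BoundedRTorsion r N) :
    BoundedRTorsion r (TensorProduct R M N) := by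
  obtain ⟨K, hK1, hK⟩ := hMb
  obtain ⟨L, hL1, hL⟩ := hNb
  refine ⟨K + L, by omega, ?_⟩
  have step : ∀ z : TensorProduct R M N, (∃ k : ℕ, r ^ k • z = 0) →
      ∃ w : TensorProduct R M N, (∃ k : ℕ, r ^ k • w = 0) ∧
        r ^ (K + L) • z = r • r ^ (K + L) • w := by
    rintro z ⟨k, hk⟩
    obtain ⟨e, he⟩ := dv_transition hK (K + L) k (by omega)
    obtain ⟨e', he'⟩ := dv_transition hL (K + L) k (by omega)
    have h1 : dvPhi r M N (K + L + k) z = 0 := by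
      apply dvPhi_ker2 hR.torsionFree hM hN _ z 0
      rw [pow_add, ← smul_smul, hk, smul_zero, smul_zero]
    have h2 : ∀ u, TensorProduct.congr e e' (dvPhi r M N (K + L) u) =
        dvPhi r M N (K + L + k) u := by
      intro u
      induction u with
      | zero => simp
      | tmul x y => rw [dvPhi_tmul, dvPhi_tmul, TensorProduct.congr_tmul, he, he']
      | add u v hu hv => rw [map_add, map_add, map_add, hu, hv]
    rw [← h2, LinearEquiv.map_eq_zero_iff] at h1
    obtain ⟨w, hw⟩ := dvPhi_ker1 _ _ h1
    refine ⟨w, ⟨k + (K + L + 1), ?_⟩, ?_⟩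
    · rw [pow_add, ← smul_smul, ← hw, smul_smul, mul_comm, ← smul_smul, hk, smul_zero]
    · rw [hw, smul_smul, pow_succ']
  intro z hz
  let Z := {z : TensorProduct R M N // ∃ k : ℕ, r ^ k • z = 0}
  choose nx hnx1 hnx2 using step
  let nxt : Z → Z := fun z => ⟨nx z.1 z.2, hnx1 z.1 z.2⟩
  let y : ℕ → Z := fun i => nxt^[i] ⟨z, hz⟩
  refine dv_sep r hR.adicComplete hT (fun i => r ^ (K + L) • (y i).1) ?_
  intro i
  have : y (i + 1) = nxt (y i) := Function.iterate_succ_apply' _ _ _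
  simp only [this]
  exact hnx2 _ _

end DvMain

theorem dv_constRank_tensor {A : Type u} [CommRing A] {P Q : Type u} [AddCommGroup P] [Module A P]
    [AddCommGroup Q] [Module A Q] (hP : ConstRank A P) (hQ : ConstRank A Q) :
    ConstRank A (TensorProduct A P Q) := by
  obtain ⟨c, hc⟩ := hP
  obtain ⟨d, hd⟩ := hQ
  refine ⟨c * d, fun p hp => ?_⟩
  obtain ⟨e⟩ := hc p hp
  obtain ⟨e'⟩ := hd p hp
  let S := p.primeCompl
  let B := Localization.AtPrime p
  let e1 : LocalizedModule S (TensorProduct A P Q) ≃ₗ[B] _ := LocalizedModule.equivTensorProduct S _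
  let e2 := TensorProduct.AlgebraTensorModule.distribBaseChange A B P Q
  let eP : TensorProduct A B P ≃ₗ[B] (Fin c → B) := (LocalizedModule.equivTensorProduct S P).symm.trans e
  let eQ : TensorProduct A B Q ≃ₗ[B] (Fin d → B) := (LocalizedModule.equivTensorProduct S Q).symm.trans e'
  let e3 := TensorProduct.congr eP eQ
  let e4 : TensorProduct B (Fin c → B) (Fin d → B) ≃ₗ[B] (Fin c × Fin d → B) :=
    ((Pi.basisFun B (Fin c)).tensorProduct (Pi.basisFun B (Fin d))).equivFun
  let e5 : (Fin c × Fin d → B) ≃ₗ[B] (Fin (c * d) → B) := LinearEquiv.funCongrLeft B B finProdFinEquiv.symm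
  exact ⟨e1.trans (e2.trans (e3.trans (e4.trans e5)))⟩

theorem dv_transport {A : Type u} [CommRing A] {P Q : Type u} [AddCommGroup P] [Module A P]
    [AddCommGroup Q] [Module A Q] (e : P ≃ₗ[A] Q) (hP : FinProjConstRank A P) :
    FinProjConstRank A Q := by
  obtain ⟨h1, h2, c, hc⟩ := hP
  refine ⟨Module.Finite.equiv e, Module.Projective.of_equiv e, c, fun p hp => ?_⟩
  obtain ⟨e'⟩ := hc p hp
  exact ⟨((LocalizedModule.equivTensorProduct p.primeCompl Q).trans
    ((TensorProduct.AlgebraTensorModule.congr (LinearEquiv.refl _ _) e.symm).trans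
      (LocalizedModule.equivTensorProduct p.primeCompl P).symm)).trans e'⟩

/-- part of Proposition `monoidal_on_detaledv`: the tensor product of two
finitely presented modules with finite projective `(r,μ)`-dévissage and bounded `r^∞`-torsion is
again such a module, and its dévissage subquotients are the tensor products of those of the
factors. -/
theorem tensorProduct_devissage {R : Type u} [CommRing R] (r : R) (hR : IsDevissageSetup R r)
    (M : Type u) [AddCommGroup M] [Module R M]
    (hMfp : Module.FinitePresentation R M) (hMdev : HasFinProjMuDevissage r M)
    (hMbd : BoundedRTorsion r M)
    (N : Type u) [AddCommGroup N] [Module R N]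
    (hNfp : Module.FinitePresentation R N) (hNdev : HasFinProjMuDevissage r N)
    (hNbd : BoundedRTorsion r N) :
    Module.FinitePresentation R (TensorProduct R M N) ∧
    HasFinProjMuDevissage r (TensorProduct R M N) ∧
    BoundedRTorsion r (TensorProduct R M N) ∧
    ∀ n : ℕ,
      letI := (muQuotSub_isTorsionBySet r M n).module
      letI := (muQuotSub_isTorsionBySet r N n).module
      letI := (muQuotSub_isTorsionBySet r (TensorProduct R M N) n).module
      Nonempty ((muQuotSub r (TensorProduct R M N) n) ≃ₗ[R ⧸ (Ideal.span {r} : Ideal R)]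
        (TensorProduct (R ⧸ (Ideal.span {r} : Ideal R)) (muQuotSub r M n) (muQuotSub r N n))) := by
  have hMp := fun n => (hMdev n).2.1
  have hNp := fun n => (hNdev n).2.1
  have hfp := dv_fp hMfp hNfp
  refine ⟨hfp, fun n => ?_, dv_bounded hR hMp hNp hfp hMbd hNbd, dv_iso hR.torsionFree hMp hNp⟩
  obtain ⟨e⟩ := dv_iso hR.torsionFree hMp hNp n
  letI := (muQuotSub_isTorsionBySet r M n).module
  letI := (muQuotSub_isTorsionBySet r N n).module
  letI := (muQuotSub_isTorsionBySet r (TensorProduct R M N) n).module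
  obtain ⟨a1, a2, a3⟩ := hMdev n
  obtain ⟨b1, b2, b3⟩ := hNdev n
  exact dv_transport e.symm ⟨inferInstance, inferInstance, dv_constRank_tensor a3 b3⟩
end

section
/- Let (R, r) be a dévissage setup such that every finitely generated projective R/rR-module is stably free. Let D₁ and D₂ be finitely presented R-modules, each with finite projective (r,μ)-dévissage and bounded r^∞-torsion. Then the R-module Hom_R(D₁, D₂) is finitely presented, has finite projective (r,μ)-dévissage, and has bounded r^∞-torsion. -/
open Pointwise

universe u

namespace Dev

section A

variable {R : Type u} [CommRing R]

/-- stably free over `R/r`, expressed `R`-linearly -/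
def SF (r : R) (Q : Type u) [AddCommGroup Q] [Module R Q] : Prop :=
  ∃ k d : ℕ, Nonempty ((Q × (Fin k → R ⧸ (Ideal.span {r} : Ideal R)))
        ≃ₗ[R] (Fin d → R ⧸ (Ideal.span {r} : Ideal R)))

/-- sum of index sets -/
noncomputable def finAdd (A : Type u) [AddCommGroup A] [Module R A] (m n : ℕ) :
    ((Fin m → A) × (Fin n → A)) ≃ₗ[R] (Fin (m + n) → A) :=
  (LinearEquiv.sumArrowLequivProdArrow (Fin m) (Fin n) R A).symm ≪≫ₗ
    LinearEquiv.funCongrLeft R A finSumFinEquiv.symm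

theorem SF.congr {r : R} {Q Q' : Type u} [AddCommGroup Q] [Module R Q] [AddCommGroup Q']
    [Module R Q'] (h : SF r Q) (e : Q ≃ₗ[R] Q') : SF r Q' := by
  obtain ⟨k, d, ⟨f⟩⟩ := h
  exact ⟨k, d, ⟨(e.symm.prodCongr (LinearEquiv.refl R _)) ≪≫ₗ f⟩⟩

theorem SF.cancel {r : R} {X Y : Type u} [AddCommGroup X] [Module R X] [AddCommGroup Y]
    [Module R Y] (h : SF r (X × Y)) (hY : SF r Y) : SF r X := by
  obtain ⟨k, d, ⟨f⟩⟩ := h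
  obtain ⟨l, m, ⟨g⟩⟩ := hY
  refine ⟨m + k, d + l, ⟨?_⟩⟩
  refine ((LinearEquiv.refl R X).prodCongr
    ((finAdd _ m k).symm ≪≫ₗ (g.symm.prodCongr (LinearEquiv.refl R _)))) ≪≫ₗ ?_
  refine ?_ ≪≫ₗ (f.prodCongr (LinearEquiv.refl R (Fin l → R ⧸ (Ideal.span {r} : Ideal R)))) ≪≫ₗ
    finAdd _ d l
  exact
    { toFun := fun p => (((p.1, p.2.1.1), p.2.2), p.2.1.2)
      invFun := fun p => (p.1.1.1, ((p.1.1.2, p.2), p.1.2))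
      map_add' := fun _ _ => rfl
      map_smul' := fun _ _ => rfl
      left_inv := fun _ => rfl
      right_inv := fun _ => rfl }

theorem SF.prod {r : R} {X Y : Type u} [AddCommGroup X] [Module R X] [AddCommGroup Y]
    [Module R Y] (hX : SF r X) (hY : SF r Y) : SF r (X × Y) := by
  obtain ⟨k, d, ⟨f⟩⟩ := hX
  obtain ⟨l, m, ⟨g⟩⟩ := hY
  refine ⟨k + l, d + m, ⟨?_⟩⟩
  refine ((LinearEquiv.refl R (X × Y)).prodCongr (finAdd _ k l).symm) ≪≫ₗ ?_ ≪≫ₗ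
    (f.prodCongr g) ≪≫ₗ finAdd _ d m
  exact
    { toFun := fun p => ((p.1.1, p.2.1), (p.1.2, p.2.2))
      invFun := fun p => ((p.1.1, p.2.1), (p.1.2, p.2.2))
      map_add' := fun _ _ => rfl
      map_smul' := fun _ _ => rfl
      left_inv := fun _ => rfl
      right_inv := fun _ => rfl }

theorem SF.zero {r : R} {X : Type u} [AddCommGroup X] [Module R X] [Subsingleton X] :
    SF r X :=
  ⟨0, 0, ⟨LinearEquiv.ofSubsingleton _ _⟩⟩

theorem SF.self {r : R} : SF r (R ⧸ (Ideal.span {r} : Ideal R)) :=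
  ⟨0, 1, ⟨(LinearEquiv.prodUnique (R := R)) ≪≫ₗ (LinearEquiv.funUnique (Fin 1) R _).symm⟩⟩

/-- map out of a cyclic module -/
noncomputable def cycMap {X : Type u} [AddCommGroup X] [Module R X] (a : R) (x : X)
    (h : a • x = 0) : (R ⧸ (Ideal.span {a} : Ideal R)) →ₗ[R] X :=
  Submodule.liftQ _ (LinearMap.toSpanSingleton R X x) (by
    intro t ht
    obtain ⟨c, rfl⟩ := Ideal.mem_span_singleton.1 ht
    simp [mul_comm a c, mul_smul, h])

theorem cycMap_mk {X : Type u} [AddCommGroup X] [Module R X] (a : R) (x : X)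
    (h : a • x = 0) (t : R) : cycMap a x h (Ideal.Quotient.mk _ t) = t • x := rfl

theorem pi_split {r : R} {X : Type u} [AddCommGroup X] [Module R X] (d : ℕ)
    (f : X →ₗ[R] (Fin d → R ⧸ (Ideal.span {r} : Ideal R))) (hf : Function.Surjective f)
    (hX : ∀ x : X, r • x = 0) :
    ∃ s : (Fin d → R ⧸ (Ideal.span {r} : Ideal R)) →ₗ[R] X, ∀ q, f (s q) = q := by
  choose g hg using hf
  let s : (Fin d → R ⧸ (Ideal.span {r} : Ideal R)) →ₗ[R] X :=
    LinearMap.lsum R _ R (fun i => cycMap r (g (Pi.single i 1)) (hX _))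
  refine ⟨s, ?_⟩
  suffices h : f ∘ₗ s = LinearMap.id from fun q => LinearMap.congr_fun h q
  apply LinearMap.pi_ext
  intro i x
  obtain ⟨t, rfl⟩ := Ideal.Quotient.mk_surjective x
  have h1 : s (Pi.single i (Ideal.Quotient.mk _ t)) = t • g (Pi.single i 1) :=
    LinearMap.lsum_piSingle R _ _ _ _ _
  simp only [LinearMap.comp_apply, h1, map_smul, hg, LinearMap.id_apply]
  rw [← Pi.single_smul]
  congr 1
  rw [Algebra.smul_def, mul_one]; rfl

theorem SF.split {r : R} {X Q : Type u} [AddCommGroup X] [Module R X] [AddCommGroup Q]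
    [Module R Q] (h : SF r Q) (f : X →ₗ[R] Q) (hf : Function.Surjective f)
    (hX : ∀ x : X, r • x = 0) : ∃ s : Q →ₗ[R] X, ∀ q, f (s q) = q := by
  obtain ⟨k, d, ⟨e⟩⟩ := h
  have hA : ∀ x : Fin k → R ⧸ (Ideal.span {r} : Ideal R), r • x = 0 := by
    intro x
    ext i
    obtain ⟨t, ht⟩ := Ideal.Quotient.mk_surjective (x i)
    rw [Pi.smul_apply, ← ht]
    change Ideal.Quotient.mk _ (r * t) = 0
    exact Ideal.Quotient.eq_zero_iff_mem.2 (Ideal.mul_mem_right _ _ (Ideal.mem_span_singleton_self r))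
  obtain ⟨s, hs⟩ := pi_split d (e.toLinearMap ∘ₗ (f.prodMap LinearMap.id))
    (e.surjective.comp (Prod.map_surjective.2 ⟨hf, Function.surjective_id⟩))
    (fun x => Prod.ext (hX _) (hA _))
  refine ⟨LinearMap.fst R _ _ ∘ₗ s ∘ₗ e.toLinearMap ∘ₗ LinearMap.inl R _ _, fun q => ?_⟩
  have := hs (e (q, 0))
  simp only [LinearMap.comp_apply, LinearEquiv.coe_coe, EmbeddingLike.apply_eq_iff_eq] at this
  simpa using congrArg Prod.fst this

/-- kernel of `M → rⁿM/rⁿ⁺¹M` -/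
def S (r : R) (M : Type u) [AddCommGroup M] [Module R M] (n : ℕ) : Submodule R M :=
  (r ^ (n + 1) • (⊤ : Submodule R M)).comap (LinearMap.lsmul R M (r ^ n))

theorem mem_S {r : R} {M : Type u} [AddCommGroup M] [Module R M] {n : ℕ} {x : M} :
    x ∈ S r M n ↔ ∃ y : M, r ^ n • x = r ^ (n + 1) • y := by
  simp only [S, Submodule.mem_comap, LinearMap.lsmul_apply, Submodule.mem_smul_pointwise_iff_exists,
    Submodule.mem_top, true_and]
  exact exists_congr fun y => eq_comm

/-- identification of the graded piece -/
noncomputable def quotEquiv (r : R) (M : Type u) [AddCommGroup M] [Module R M] (n : ℕ) :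
    (M ⧸ S r M n) ≃ₗ[R] muQuotSub r M n := by
  let f : M →ₗ[R] muQuotSub r M n :=
    ((r ^ (n + 1) • (⊤ : Submodule R M)).mkQ ∘ₗ LinearMap.lsmul R M (r ^ n)).codRestrict _
      (fun x => Submodule.mem_map_of_mem
        (Submodule.smul_mem_pointwise_smul _ _ _ Submodule.mem_top))
  have hf : Function.Surjective f := by
    rintro ⟨x, hx⟩
    obtain ⟨m, hm, rfl⟩ := hx
    obtain ⟨m', -, rfl⟩ := hm
    exact ⟨m', rfl⟩
  have hk : S r M n = LinearMap.ker f := by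
    ext x
    simp only [S, Submodule.mem_comap, LinearMap.mem_ker, f]
    rw [← Submodule.Quotient.mk_eq_zero]
    exact (Subtype.ext_iff (a1 := f x) (a2 := 0)).symm
  exact (Submodule.quotEquivOfEq _ _ hk) ≪≫ₗ f.quotKerEquivOfSurjective hf

theorem sf_of_dev {r : R}
    (hK0 : ∀ (P : Type u) (_ : AddCommGroup P) (_ : Module (R ⧸ (Ideal.span {r} : Ideal R)) P),
      Module.Finite (R ⧸ (Ideal.span {r} : Ideal R)) P →
      Module.Projective (R ⧸ (Ideal.span {r} : Ideal R)) P →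
      ∃ k d : ℕ, Nonempty ((P × (Fin k → R ⧸ (Ideal.span {r} : Ideal R)))
        ≃ₗ[R ⧸ (Ideal.span {r} : Ideal R)] (Fin d → R ⧸ (Ideal.span {r} : Ideal R))))
    {M : Type u} [AddCommGroup M] [Module R M] (h : HasFinProjMuDevissage r M) (n : ℕ) :
    SF r (M ⧸ S r M n) := by
  let := (muQuotSub_isTorsionBySet r M n).module
  have : IsScalarTower R (R ⧸ (Ideal.span {r} : Ideal R)) (muQuotSub r M n) :=
    (muQuotSub_isTorsionBySet r M n).isScalarTower
  obtain ⟨h1, h2, -⟩ := h n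
  obtain ⟨k, d, ⟨e⟩⟩ := hK0 (muQuotSub r M n) _ _ h1 h2
  have : SF r (muQuotSub r M n) := ⟨k, d, ⟨e.restrictScalars R⟩⟩
  exact this.congr (quotEquiv r M n).symm

theorem constRank_of {A : Type u} [CommRing A] {Q : Type u} [AddCommGroup Q] [Module A Q]
    {k d : ℕ} (e : (Q × (Fin k → A)) ≃ₗ[A] (Fin d → A)) : FinProjConstRank A Q := by
  have hfin : Module.Finite A Q :=
    Module.Finite.of_surjective (LinearMap.fst A _ _ ∘ₗ e.symm.toLinearMap)
      (Prod.fst_surjective.comp e.symm.surjective)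
  have hproj : Module.Projective A Q := by
    refine Module.Projective.of_split (e.toLinearMap ∘ₗ LinearMap.inl A Q (Fin k → A))
      (LinearMap.fst A _ _ ∘ₗ e.symm.toLinearMap) ?_
    ext x; simp
  refine ⟨hfin, hproj, d - k, fun p hp => ?_⟩
  have : Nontrivial A := ⟨⟨0, 1, fun h => hp.ne_top ((Ideal.eq_top_iff_one _).2 (h ▸ zero_mem p))⟩⟩
  have h1 := congrFun (Module.rankAtStalk_eq_of_equiv e) ⟨p, hp⟩
  rw [Module.rankAtStalk_prod, Pi.add_apply,
    Module.rankAtStalk_eq_finrank_of_free (M := Fin k → A),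
    Module.rankAtStalk_eq_finrank_of_free (M := Fin d → A)] at h1
  simp only [Pi.natCast_apply, Module.finrank_fin_fun, Nat.cast_id] at h1
  have h2 : Module.finrank (Localization.AtPrime p) (LocalizedModule p.primeCompl Q) = d - k := by
    have : Module.rankAtStalk Q ⟨p, hp⟩ = d - k := by omega
    exact this
  have : Module.Free (Localization.AtPrime p) (LocalizedModule p.primeCompl Q) :=
    Module.free_of_flat_of_isLocalRing
  exact ⟨(Module.finBasisOfFinrankEq _ _ h2).equivFun⟩

theorem dev_of_sf {r : R} {M : Type u} [AddCommGroup M] [Module R M]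
    (h : ∀ n, SF r (M ⧸ S r M n)) : HasFinProjMuDevissage r M := by
  intro n
  let := (muQuotSub_isTorsionBySet r M n).module
  have : IsScalarTower R (R ⧸ (Ideal.span {r} : Ideal R)) (muQuotSub r M n) :=
    (muQuotSub_isTorsionBySet r M n).isScalarTower
  obtain ⟨k, d, ⟨e⟩⟩ := (h n).congr (quotEquiv r M n)
  exact constRank_of (e.extendScalarsOfSurjective (S := R ⧸ (Ideal.span {r} : Ideal R))
    Ideal.Quotient.mk_surjective)

end A

section B

variable {R : Type u} [CommRing R]

/-- finite direct sums of cyclic modules `R`, `R/r^(k+1)` -/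
inductive Good (r : R) : ∀ (X : Type u) [AddCommGroup X] [Module R X], Prop
  | zero (X : Type u) [AddCommGroup X] [Module R X] (h : Subsingleton X) : Good r X
  | cyc (a : R) (ha : a = 0 ∨ ∃ k : ℕ, a = r ^ (k + 1)) :
      Good r (R ⧸ (Ideal.span {a} : Ideal R))
  | prod (X Y : Type u) [AddCommGroup X] [Module R X] [AddCommGroup Y] [Module R Y]
      (hX : Good r X) (hY : Good r Y) : Good r (X × Y)
  | iso (X Y : Type u) [AddCommGroup X] [Module R X] [AddCommGroup Y] [Module R Y]
      (hX : Good r X) (e : X ≃ₗ[R] Y) : Good r Y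

theorem Good.pi {r : R} {X : Type u} [AddCommGroup X] [Module R X] (hX : Good r X) (k : ℕ) :
    Good r (Fin k → X) := by
  induction k with
  | zero => exact Good.zero _ inferInstance
  | succ k ih => exact Good.iso _ _ (Good.prod _ _ hX ih) (Fin.consLinearEquiv R (fun _ => X))

theorem Good.self {r : R} : Good r R :=
  Good.iso _ _ (Good.cyc 0 (Or.inl rfl)) (Submodule.quotEquivOfEqBot _ (by simp))

/-- the module `Ẽ` with `r Ẽ ≅ E` -/
def Til (r : R) (E : Type u) [AddCommGroup E] [Module R E] : Prop :=
  ∃ (E' : Type u) (_ : AddCommGroup E') (_ : Module R E') (p : E' →ₗ[R] E) (j : E →ₗ[R] E'),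
    Good r E' ∧ Function.Surjective p ∧ Function.Injective j ∧ (∀ e, j (p e) = r • e) ∧
    (∀ e : E', r • e = 0 → ∃ e₂ : E', e = r • e₂) ∧
    ∀ (D : Type u) [AddCommGroup D] [Module R D] (ψ : E →ₗ[R] D), (∀ x, ∃ y, ψ x = r • y) →
      ∃ Φ : E' →ₗ[R] D, ∀ e, r • Φ e = ψ (p e)

theorem til_cyc {r : R} (hr : ∀ x : R, r * x = 0 → x = 0) (a : R)
    (ha : a = 0 ∨ ∃ k : ℕ, a = r ^ (k + 1)) : Til r (R ⧸ (Ideal.span {a} : Ideal R)) := by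
  have hr' : ∀ x y : R, r * x = r * y → x = y := fun x y h =>
    sub_eq_zero.1 (hr _ (by rw [mul_sub, h, sub_self]))
  have hmk : ∀ (c : R) (t : R), t • (Ideal.Quotient.mk (Ideal.span {c}) 1) =
      Ideal.Quotient.mk (Ideal.span {c}) t := by
    intro c t
    rw [Algebra.smul_def, map_one, mul_one]; rfl
  have hsm : ∀ (c s t : R), s • (Ideal.Quotient.mk (Ideal.span {c}) t) =
      Ideal.Quotient.mk (Ideal.span {c}) (s * t) := fun c s t => rfl
  refine ⟨R ⧸ (Ideal.span {r * a} : Ideal R), inferInstance, inferInstance,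
    cycMap (r * a) (Ideal.Quotient.mk _ 1) ?_, cycMap a (Ideal.Quotient.mk _ r) ?_,
    Good.cyc _ ?_, ?_, ?_, ?_, ?_, ?_⟩
  · rw [hmk, Ideal.Quotient.eq_zero_iff_mem, Ideal.mem_span_singleton]
    exact Dvd.intro_left r rfl
  · rw [hsm, Ideal.Quotient.eq_zero_iff_mem, Ideal.mem_span_singleton, mul_comm]
  · rcases ha with rfl | ⟨k, rfl⟩
    · left; simp
    · right; exact ⟨k + 1, (pow_succ' r (k + 1)).symm⟩
  · intro y
    obtain ⟨t, rfl⟩ := Ideal.Quotient.mk_surjective y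
    exact ⟨Ideal.Quotient.mk _ t, by rw [cycMap_mk, hmk]⟩
  · rw [injective_iff_map_eq_zero]
    intro y hy
    obtain ⟨t, rfl⟩ := Ideal.Quotient.mk_surjective y
    rw [cycMap_mk, hsm, Ideal.Quotient.eq_zero_iff_mem, Ideal.mem_span_singleton] at hy
    obtain ⟨c, hc⟩ := hy
    rw [Ideal.Quotient.eq_zero_iff_mem, Ideal.mem_span_singleton]
    exact ⟨c, hr' _ _ (by rw [mul_comm r t, hc, mul_assoc])⟩
  · intro y
    obtain ⟨t, rfl⟩ := Ideal.Quotient.mk_surjective y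
    rw [cycMap_mk, hmk, cycMap_mk, hsm, hsm, mul_comm t r]
  · intro y hy
    obtain ⟨t, rfl⟩ := Ideal.Quotient.mk_surjective y
    rw [hsm, Ideal.Quotient.eq_zero_iff_mem, Ideal.mem_span_singleton] at hy
    obtain ⟨c, hc⟩ := hy
    have ht : t = a * c := hr' _ _ (by rw [hc, mul_assoc])
    rcases ha with rfl | ⟨k, rfl⟩
    · exact ⟨0, by simp [ht]⟩
    · refine ⟨Ideal.Quotient.mk _ (r ^ k * c), ?_⟩
      rw [hsm, ht]; congr 1; ring
  · intro D _ _ ψ hψ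
    obtain ⟨y, hy⟩ := hψ (Ideal.Quotient.mk _ 1)
    refine ⟨cycMap (r * a) y ?_, ?_⟩
    · rw [mul_comm, mul_smul, ← hy, ← map_smul, hmk, Ideal.Quotient.eq_zero_iff_mem.2
        (Ideal.mem_span_singleton_self a), map_zero]
    · intro e
      obtain ⟨t, rfl⟩ := Ideal.Quotient.mk_surjective e
      rw [cycMap_mk, cycMap_mk, map_smul, hy, smul_comm]

theorem Good.til {r : R} (hr : ∀ x : R, r * x = 0 → x = 0) {E : Type u} [AddCommGroup E]
    [Module R E] (h : Good r E) : Til r E := by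
  induction h with
  | zero X h =>
    refine ⟨X, inferInstance, inferInstance, LinearMap.id, LinearMap.id, Good.zero X h,
      Function.surjective_id, Function.injective_id, fun _ => Subsingleton.elim _ _,
      fun _ _ => ⟨0, Subsingleton.elim _ _⟩, fun D _ _ ψ hψ => ⟨0, fun e => ?_⟩⟩
    rw [Subsingleton.elim (LinearMap.id e) (0 : X)]; simp
  | cyc a ha => exact til_cyc hr a ha
  | prod X Y hX hY ihX ihY =>
    obtain ⟨X', _, _, p, j, hG, hp, hj, hjp, ht, hl⟩ := ihX
    obtain ⟨Y', _, _, p', j', hG', hp', hj', hjp', ht', hl'⟩ := ihY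
    refine ⟨X' × Y', inferInstance, inferInstance, p.prodMap p', j.prodMap j', Good.prod _ _ hG hG',
      Prod.map_surjective.2 ⟨hp, hp'⟩, Prod.map_injective.2 ⟨hj, hj'⟩,
      fun e => Prod.ext (hjp _) (hjp' _), ?_, ?_⟩
    · intro e he
      obtain ⟨a, ha⟩ := ht e.1 (congrArg Prod.fst he)
      obtain ⟨b, hb⟩ := ht' e.2 (congrArg Prod.snd he)
      exact ⟨(a, b), Prod.ext ha hb⟩
    · intro D _ _ ψ hψ
      obtain ⟨F, hF⟩ := hl D (ψ ∘ₗ LinearMap.inl R X Y) (fun x => hψ _)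
      obtain ⟨G, hG⟩ := hl' D (ψ ∘ₗ LinearMap.inr R X Y) (fun x => hψ _)
      refine ⟨F.coprod G, fun e => ?_⟩
      rw [LinearMap.coprod_apply, smul_add, hF, hG]
      simp [← map_add]
  | iso X Y hX e ih =>
    obtain ⟨X', _, _, p, j, hG, hp, hj, hjp, ht, hl⟩ := ih
    refine ⟨X', inferInstance, inferInstance, e.toLinearMap ∘ₗ p, j ∘ₗ e.symm.toLinearMap, hG,
      e.surjective.comp hp, hj.comp e.symm.injective, fun x => by simp [hjp], ht, ?_⟩
    intro D _ _ ψ hψ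
    obtain ⟨F, hF⟩ := hl D (ψ ∘ₗ e.toLinearMap) (fun x => hψ _)
    exact ⟨F, fun x => hF x⟩

/-- the complement of `D[r] ∩ rD` in `D[r]` -/
theorem exists_compl {r : R} {D : Type u} [AddCommGroup D] [Module R D]
    (h0 : SF r (D ⧸ S r D 0)) (h1 : SF r (D ⧸ S r D 1)) :
    ∃ (C : Type u) (_ : AddCommGroup C) (_ : Module R C) (s : C →ₗ[R] D), SF r C ∧
      (∀ c, r • s c = 0) ∧ (∀ c y, s c = r • y → c = 0) ∧
      (∀ y, r • y = 0 → ∃ c z, y = s c + r • z) := by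
  have hle : S r D 0 ≤ S r D 1 := by
    intro x hx
    obtain ⟨y, hy⟩ := mem_S.1 hx
    refine mem_S.2 ⟨y, ?_⟩
    simp only [pow_zero, one_smul, zero_add, pow_one] at hy
    rw [hy, smul_smul]; congr 1; ring
  have hz0 : ∀ (x y : D), x = r • y → (S r D 0).mkQ x = 0 := by
    intro x y h
    rw [Submodule.mkQ_apply, Submodule.Quotient.mk_eq_zero]
    exact mem_S.2 ⟨y, by simpa using h⟩
  let π : (D ⧸ S r D 0) →ₗ[R] (D ⧸ S r D 1) := Submodule.factor hle
  have hπ : Function.Surjective π := Submodule.factor_surjective hle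
  obtain ⟨σ, hσ⟩ := h1.split π hπ (by
    intro x
    obtain ⟨x, rfl⟩ := Submodule.mkQ_surjective _ x
    rw [← map_smul]
    exact hz0 _ _ rfl)
  have hC : SF r (LinearMap.ker π) := by
    refine SF.cancel (Y := D ⧸ S r D 1) (h0.congr ?_) h1
    refine LinearEquiv.ofLinearMap
      (((LinearMap.id - σ ∘ₗ π).codRestrict (LinearMap.ker π) (fun x => by simp [hσ])).prod π)
      ((LinearMap.ker π).subtype.coprod σ) ?_ ?_
    · apply LinearMap.ext
      rintro ⟨⟨x, hx⟩, y⟩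
      rw [LinearMap.mem_ker] at hx
      refine Prod.ext (Subtype.ext ?_) ?_ <;> simp [hσ, hx]
    · apply LinearMap.ext
      intro x
      simp
  let T : Submodule R D := LinearMap.ker (LinearMap.lsmul R D r)
  let f : T →ₗ[R] LinearMap.ker π :=
    ((S r D 0).mkQ ∘ₗ T.subtype).codRestrict _ (by
      rintro ⟨x, hx⟩
      change (S r D 1).mkQ x = 0
      rw [Submodule.mkQ_apply, Submodule.Quotient.mk_eq_zero]
      have hx' : r • x = 0 := hx
      exact mem_S.2 ⟨0, by simp [hx']⟩)
  have hf : Function.Surjective f := by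
    rintro ⟨q, hq⟩
    obtain ⟨x, rfl⟩ := Submodule.mkQ_surjective _ q
    have hq' : (S r D 1).mkQ x = 0 := hq
    rw [Submodule.mkQ_apply, Submodule.Quotient.mk_eq_zero] at hq'
    obtain ⟨y, hy⟩ := mem_S.1 hq'
    refine ⟨⟨x - r • y, ?_⟩, Subtype.ext ?_⟩
    · change r • (x - r • y) = 0
      rw [smul_sub, smul_smul, sub_eq_zero]
      simpa [pow_two] using hy
    · change (S r D 0).mkQ (x - r • y) = (S r D 0).mkQ x
      rw [map_sub, hz0 _ _ rfl, sub_zero]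
  obtain ⟨s, hs⟩ := hC.split f hf (fun x => Subtype.ext x.2)
  refine ⟨LinearMap.ker π, inferInstance, inferInstance, T.subtype ∘ₗ s, hC, fun c => (s c).2,
    ?_, ?_⟩
  · intro c y h
    rw [← hs c]
    exact Subtype.ext (hz0 _ _ h)
  · intro y hy
    refine ⟨f ⟨y, hy⟩, ?_⟩
    have h2 := congrArg Subtype.val (hs (f ⟨y, hy⟩))
    change (S r D 0).mkQ (s (f ⟨y, hy⟩) : D) = (S r D 0).mkQ y at h2
    have h3 : y - (s (f ⟨y, hy⟩) : D) ∈ S r D 0 := by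
      rw [← Submodule.Quotient.mk_eq_zero, ← Submodule.mkQ_apply, map_sub, h2, sub_self]
    obtain ⟨z, hz⟩ := mem_S.1 h3
    refine ⟨z, ?_⟩
    simp only [pow_zero, one_smul, zero_add, pow_one] at hz
    rw [← hz]; simp

/-- torsion-free case -/
theorem decomp_zero {r : R} (hR : IsDevissageSetup R r) {D : Type u} [AddCommGroup D]
    [Module R D] [Module.Finite R D] (h0 : SF r (D ⧸ S r D 0))
    (hT : ∀ x : D, r • x = 0 → x = 0) :
    ∃ k d : ℕ, Nonempty ((D × (Fin k → R)) ≃ₗ[R] (Fin d → R)) := by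
  obtain ⟨k, d, ⟨e⟩⟩ := h0
  refine ⟨k, d, ⟨?_⟩⟩
  let A := R ⧸ (Ideal.span {r} : Ideal R)
  let m : R →ₗ[R] A := (Ideal.span {r} : Ideal R).mkQ
  have hm : Function.Surjective m := Submodule.mkQ_surjective _
  have hm0 : ∀ t, m t = 0 → ∃ c, t = r * c := by
    intro t ht
    exact Ideal.mem_span_singleton.1 ((Submodule.Quotient.mk_eq_zero _).1 ht)
  have hmn : ∀ (n : ℕ) (x : Fin n → R), m.compLeft (Fin n) x = 0 → ∃ y, x = r • y := by
    intro n x hx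
    choose y hy using fun i => hm0 (x i) (congrFun hx i)
    exact ⟨y, funext hy⟩
  have hms : ∀ n, Function.Surjective (m.compLeft (Fin n)) := by
    intro n y
    choose x hx using fun i => hm (y i)
    exact ⟨x, funext hx⟩
  let q : (D × (Fin k → R)) →ₗ[R] (D ⧸ S r D 0) × (Fin k → A) :=
    (S r D 0).mkQ.prodMap (m.compLeft (Fin k))
  have hq : Function.Surjective q :=
    Prod.map_surjective.2 ⟨Submodule.mkQ_surjective _, hms k⟩
  have hq0 : ∀ z, q z = 0 → ∃ w, z = r • w := by
    rintro ⟨x, y⟩ h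
    have h1 : (S r D 0).mkQ x = 0 := congrArg Prod.fst h
    rw [Submodule.mkQ_apply, Submodule.Quotient.mk_eq_zero] at h1
    obtain ⟨x', hx'⟩ := mem_S.1 h1
    obtain ⟨y', hy'⟩ := hmn k y (congrArg Prod.snd h)
    exact ⟨(x', y'), Prod.ext (by simpa using hx') hy'⟩
  choose g hg using fun i : Fin d => (e.surjective.comp hq) (Pi.single i (m 1))
  let φ : (Fin d → R) →ₗ[R] (D × (Fin k → R)) :=
    LinearMap.lsum R _ R (fun i => LinearMap.toSpanSingleton R _ (g i))
  have hφ : ∀ x, e (q (φ x)) = m.compLeft (Fin d) x := by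
    suffices h : e.toLinearMap ∘ₗ q ∘ₗ φ = m.compLeft (Fin d) from
      fun x => LinearMap.congr_fun h x
    apply LinearMap.pi_ext
    intro i t
    have h1 : φ (Pi.single i t) = t • g i := LinearMap.lsum_piSingle R _ _ _ _ _
    have h2 : e (q (g i)) = Pi.single i (m 1) := hg i
    rw [LinearMap.comp_apply, LinearMap.comp_apply, h1, map_smul, map_smul]
    rw [LinearEquiv.coe_coe, h2, ← Pi.single_smul, ← map_smul, smul_eq_mul, mul_one]
    ext l
    by_cases hl : l = i
    · subst hl; simp
    · simp [Pi.single_eq_of_ne hl]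
  have hT' : ∀ z : D × (Fin k → R), r • z = 0 → z = 0 := by
    rintro ⟨x, y⟩ h
    exact Prod.ext (hT _ (congrArg Prod.fst h))
      (funext fun i => hR.torsionFree _ (congrFun (congrArg Prod.snd h) i))
  have := hR.adicComplete
  refine LinearEquiv.symm (LinearEquiv.ofBijective φ ⟨?_, ?_⟩)
  · rw [injective_iff_map_eq_zero]
    have key : ∀ n : ℕ, ∀ x, φ x = 0 → ∃ y, x = r ^ n • y := by
      intro n
      induction n with
      | zero => exact fun x _ => ⟨x, by simp⟩
      | succ n ih =>
        intro x hx
        obtain ⟨y, rfl⟩ := hmn d x (by rw [← hφ, hx, map_zero, map_zero])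
        rw [map_smul] at hx
        obtain ⟨z, rfl⟩ := ih y (hT' _ hx)
        exact ⟨z, by rw [smul_smul, pow_succ']⟩
    intro x hx
    funext i
    apply IsHausdorff.haus (I := Ideal.span {r}) inferInstance
    intro n
    obtain ⟨y, rfl⟩ := key n x hx
    rw [SModEq.zero, Ideal.span_singleton_pow, smul_eq_mul, Ideal.mul_top]
    exact Ideal.mem_span_singleton.2 ⟨y i, rfl⟩
  · rw [← LinearMap.range_eq_top, ← top_le_iff]
    refine Submodule.le_of_le_smul_of_le_jacobson_bot (I := Ideal.span {r}) Module.Finite.fg_top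
      (IsAdicComplete.le_jacobson_bot _) ?_
    intro y _
    obtain ⟨x, hx⟩ := hms d (e (q y))
    rw [← hφ] at hx
    obtain ⟨w, hw⟩ := hq0 (y - φ x) (by rw [map_sub, e.injective hx, sub_self])
    rw [show y = φ x + r • w by rw [← hw]; abel]
    exact Submodule.add_mem_sup ⟨x, rfl⟩
      (Submodule.smul_mem_smul (Ideal.mem_span_singleton_self r) Submodule.mem_top)

theorem decomp_thm {r : R} (hR : IsDevissageSetup R r) (N : ℕ) :
    ∀ (D : Type u) [AddCommGroup D] [Module R D] [Module.Finite R D],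
      (∀ n, SF r (D ⧸ S r D n)) →
      (∀ x : D, (∃ k : ℕ, r ^ k • x = 0) → r ^ N • x = 0) →
      ∃ (F : Type u) (_ : AddCommGroup F) (_ : Module R F)
        (E : Type u) (_ : AddCommGroup E) (_ : Module R E),
        Good r F ∧ Good r E ∧ Nonempty ((D × F) ≃ₗ[R] E) := by
  induction N with
  | zero =>
    intro D _ _ _ hS hT
    obtain ⟨k, d, ⟨e⟩⟩ := decomp_zero hR (hS 0)
      (fun x hx => by simpa using hT x ⟨1, by simpa using hx⟩)
    exact ⟨_, inferInstance, inferInstance, _, inferInstance, inferInstance, Good.self.pi k,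
      Good.self.pi d, ⟨e⟩⟩
  | succ N ih =>
    intro D _ _ _ hS hT
    let M : Submodule R D := LinearMap.range (LinearMap.lsmul R D r)
    have hM : ∀ n, SF r (M ⧸ S r M n) := by
      intro n
      let f : D →ₗ[R] M ⧸ S r M n := (S r M n).mkQ ∘ₗ (LinearMap.lsmul R D r).rangeRestrict
      have hf : Function.Surjective f :=
        (Submodule.mkQ_surjective _).comp (LinearMap.surjective_rangeRestrict _)
      have hk : S r D (n + 1) = LinearMap.ker f := by
        ext x
        rw [LinearMap.mem_ker, LinearMap.comp_apply, Submodule.mkQ_apply,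
          Submodule.Quotient.mk_eq_zero, mem_S, mem_S]
        constructor
        · rintro ⟨y, hy⟩
          refine ⟨⟨r • y, ⟨y, rfl⟩⟩, Subtype.ext ?_⟩
          change r ^ n • r • x = r ^ (n + 1) • r • y
          rw [smul_smul, smul_smul, ← pow_succ, ← pow_succ, hy]
        · rintro ⟨⟨_, ⟨y, rfl⟩⟩, hy⟩
          refine ⟨y, ?_⟩
          have := congrArg Subtype.val hy
          change r ^ n • r • x = r ^ (n + 1) • r • y at this
          rwa [smul_smul, smul_smul, ← pow_succ, ← pow_succ] at this
      exact (hS (n + 1)).congr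
        ((Submodule.quotEquivOfEq _ _ hk) ≪≫ₗ f.quotKerEquivOfSurjective hf)
    obtain ⟨E, _, _, E', _, _, hE, hE', ⟨θ⟩⟩ := ih M hM (by
      rintro ⟨_, ⟨y, rfl⟩⟩ ⟨k, hk⟩
      have hk' : r ^ k • r • y = 0 := congrArg Subtype.val hk
      apply Subtype.ext
      change r ^ N • r • y = 0
      rw [smul_smul, ← pow_succ] at hk' ⊢
      exact hT y ⟨k + 1, hk'⟩)
    obtain ⟨X, _, _, p, j, hX, hp, hj, hjp, ht, -⟩ := hE.til hR.torsionFree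
    obtain ⟨X', _, _, p', j', hX', hp', hj', hjp', ht', hl'⟩ := hE'.til hR.torsionFree
    obtain ⟨C, _, _, s, hC, hs0, hs1, hs2⟩ := exists_compl (hS 0) (hS 1)
    let ψ : E' →ₗ[R] D × X := (M.subtype.prodMap j) ∘ₗ θ.symm.toLinearMap
    have hψi : Function.Injective ψ :=
      (Prod.map_injective.2 ⟨Subtype.val_injective, hj⟩).comp θ.symm.injective
    have hψr : ∀ x, ∃ y, ψ x = r • y := by
      intro x
      obtain ⟨y, hy⟩ := (θ.symm x).1.2
      obtain ⟨z, hz⟩ := hp (θ.symm x).2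
      refine ⟨(y, z), Prod.ext hy.symm ?_⟩
      change j (θ.symm x).2 = r • z
      rw [← hz, hjp]
    have hψs : ∀ y, ∃ x, ψ x = r • y := by
      intro y
      refine ⟨θ (⟨r • y.1, ⟨y.1, rfl⟩⟩, p y.2), ?_⟩
      simp only [ψ, LinearMap.comp_apply, LinearEquiv.coe_coe, LinearEquiv.symm_apply_apply]
      exact Prod.ext rfl (hjp _)
    obtain ⟨Φ, hΦ⟩ := hl' _ ψ hψr
    have hΦs : ∀ y, ∃ e, r • Φ e = r • y := by
      intro y
      obtain ⟨x, hx⟩ := hψs y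
      obtain ⟨e, rfl⟩ := hp' x
      exact ⟨e, by rw [hΦ, hx]⟩
    have hΦi : ∀ e, r • Φ e = 0 → r • e = 0 := by
      intro e he
      rw [hΦ] at he
      rw [← hjp', (injective_iff_map_eq_zero ψ).1 hψi _ he, map_zero]
    let G : X' × C →ₗ[R] D × X := Φ.coprod (LinearMap.inl R D X ∘ₗ s)
    have hG : ∀ e c, G (e, c) = Φ e + (s c, 0) := fun e c => rfl
    have hGb : Function.Bijective G := by
      constructor
      · rw [injective_iff_map_eq_zero]
        rintro ⟨e, c⟩ h
        rw [hG] at h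
        have h1 : r • Φ e = 0 := by
          have h3 : r • ((s c, 0) : D × X) = 0 := Prod.ext (hs0 c) (smul_zero r)
          have h4 : r • (Φ e + ((s c, 0) : D × X)) = r • (0 : D × X) := congrArg (fun z => r • z) h
          rwa [smul_add, h3, add_zero, smul_zero] at h4
        obtain ⟨e₂, rfl⟩ := ht' e (hΦi e h1)
        rw [map_smul] at h
        have hc : c = 0 := by
          refine hs1 c (-(Φ e₂).1) ?_
          have := congrArg Prod.fst h
          simp only [Prod.fst_add, Prod.smul_fst, Prod.fst_zero] at this
          rw [smul_neg]
          exact eq_neg_of_add_eq_zero_right this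
        subst hc
        rw [map_zero] at h
        have h2 : r • Φ e₂ = 0 := by
          rw [← h]; exact (add_zero _).symm
        rw [hΦi _ h2]; rfl
      · intro y
        obtain ⟨e, he⟩ := hΦs y
        have hz : r • (y - Φ e) = 0 := by rw [smul_sub, he, sub_self]
        obtain ⟨c, z₁, hz₁⟩ := hs2 (y - Φ e).1 (congrArg Prod.fst hz)
        obtain ⟨z₂, hz₂⟩ := ht (y - Φ e).2 (congrArg Prod.snd hz)
        obtain ⟨e₂, he₂⟩ := hΦs (z₁, z₂)
        refine ⟨(e + r • e₂, c), ?_⟩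
        rw [hG, map_add, map_smul, he₂]
        have : y - Φ e = (s c, 0) + r • (z₁, z₂) := by
          refine Prod.ext hz₁ ?_
          rw [hz₂]; simp
        rw [add_assoc, add_comm (r • (z₁, z₂)), ← this]; abel
    obtain ⟨k, d, ⟨ε⟩⟩ := hC
    have hA : Good r (R ⧸ (Ideal.span {r} : Ideal R)) := Good.cyc r (Or.inr ⟨0, by simp⟩)
    refine ⟨X × (Fin k → R ⧸ (Ideal.span {r} : Ideal R)), inferInstance, inferInstance,
      X' × (Fin d → R ⧸ (Ideal.span {r} : Ideal R)), inferInstance, inferInstance,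
      Good.prod _ _ hX (hA.pi k), Good.prod _ _ hX' (hA.pi d), ⟨?_⟩⟩
    exact (LinearEquiv.prodAssoc R D X _).symm ≪≫ₗ
      ((LinearEquiv.ofBijective G hGb).symm.prodCongr (LinearEquiv.refl R _)) ≪≫ₗ
      (LinearEquiv.prodAssoc R X' C _) ≪≫ₗ ((LinearEquiv.refl R X').prodCongr ε)

end B

section C

variable {R : Type u} [CommRing R]

/-- the target property -/
def T (r : R) (M : Type u) [AddCommGroup M] [Module R M] : Prop :=
  Module.FinitePresentation R M ∧ (∀ n, SF r (M ⧸ S r M n)) ∧ BoundedRTorsion r M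

theorem T.congr {r : R} {X Y : Type u} [AddCommGroup X] [Module R X] [AddCommGroup Y]
    [Module R Y] (h : T r X) (e : X ≃ₗ[R] Y) : T r Y := by
  obtain ⟨h1, h2, N, hN, h3⟩ := h
  refine ⟨Module.FinitePresentation.of_equiv e, fun n => ?_, N, hN, ?_⟩
  · refine (h2 n).congr (Submodule.Quotient.equiv _ _ e ?_)
    ext y
    rw [Submodule.mem_map]
    constructor
    · rintro ⟨x, hx, rfl⟩
      obtain ⟨z, hz⟩ := mem_S.1 hx
      exact mem_S.2 ⟨e z, by simpa using congrArg e hz⟩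
    · intro hy
      obtain ⟨z, hz⟩ := mem_S.1 hy
      exact ⟨e.symm y, mem_S.2 ⟨e.symm z, by simpa using congrArg e.symm hz⟩, by simp⟩
  · rintro y ⟨k, hk⟩
    have := h3 (e.symm y) ⟨k, by simpa using congrArg e.symm hk⟩
    simpa using congrArg e this

/-- graded pieces of a product -/
noncomputable def quotProd (r : R) (X Y : Type u) [AddCommGroup X] [Module R X] [AddCommGroup Y]
    [Module R Y] (n : ℕ) :
    ((X × Y) ⧸ S r (X × Y) n) ≃ₗ[R] (X ⧸ S r X n) × (Y ⧸ S r Y n) := by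
  let f : X × Y →ₗ[R] (X ⧸ S r X n) × (Y ⧸ S r Y n) := (S r X n).mkQ.prodMap (S r Y n).mkQ
  have hf : Function.Surjective f :=
    Prod.map_surjective.2 ⟨Submodule.mkQ_surjective _, Submodule.mkQ_surjective _⟩
  have hk : S r (X × Y) n = LinearMap.ker f := by
    ext ⟨x, y⟩
    rw [LinearMap.mem_ker, mem_S, LinearMap.prodMap_apply, Prod.mk_eq_zero,
      Submodule.mkQ_apply, Submodule.Quotient.mk_eq_zero, mem_S,
      Submodule.mkQ_apply, Submodule.Quotient.mk_eq_zero, mem_S]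
    constructor
    · rintro ⟨z, hz⟩
      exact ⟨⟨z.1, congrArg Prod.fst hz⟩, ⟨z.2, congrArg Prod.snd hz⟩⟩
    · rintro ⟨⟨z, hz⟩, ⟨w, hw⟩⟩
      exact ⟨(z, w), Prod.ext hz hw⟩
  exact (Submodule.quotEquivOfEq _ _ hk) ≪≫ₗ f.quotKerEquivOfSurjective hf

theorem T.prod {r : R} {X Y : Type u} [AddCommGroup X] [Module R X] [AddCommGroup Y]
    [Module R Y] (hX : T r X) (hY : T r Y) : T r (X × Y) := by
  obtain ⟨h1, h2, N, hN, h3⟩ := hX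
  obtain ⟨h1', h2', N', hN', h3'⟩ := hY
  refine ⟨inferInstance, fun n => ((h2 n).prod (h2' n)).congr (quotProd r X Y n).symm,
    N + N', by omega, ?_⟩
  rintro ⟨x, y⟩ ⟨k, hk⟩
  have hx := h3 x ⟨k, congrArg Prod.fst hk⟩
  have hy := h3' y ⟨k, congrArg Prod.snd hk⟩
  refine Prod.ext ?_ ?_
  · change r ^ (N + N') • x = 0
    rw [add_comm, pow_add, mul_smul, hx, smul_zero]
  · change r ^ (N + N') • y = 0
    rw [pow_add, mul_smul, hy, smul_zero]

theorem T.cancel {r : R} {X Y : Type u} [AddCommGroup X] [Module R X] [AddCommGroup Y]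
    [Module R Y] (h : T r (X × Y)) (hY : T r Y) : T r X := by
  obtain ⟨h1, h2, N, hN, h3⟩ := h
  refine ⟨?_, fun n => ((h2 n).congr (quotProd r X Y n)).cancel (hY.2.1 n), N, hN, ?_⟩
  · have := hY.1
    refine Module.finitePresentation_of_surjective (LinearMap.fst R X Y) Prod.fst_surjective ?_
    rw [LinearMap.ker_fst]
    exact Module.Finite.iff_fg.1 inferInstance
  · rintro x ⟨k, hk⟩
    exact congrArg Prod.fst (h3 (x, 0) ⟨k, Prod.ext hk (smul_zero _)⟩)

theorem T.zero {r : R} {X : Type u} [AddCommGroup X] [Module R X] [Subsingleton X] : T r X :=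
  ⟨inferInstance, fun _ => SF.zero, 1, le_rfl, fun _ _ => Subsingleton.elim _ _⟩

theorem pow_cancel {r : R} (hr : ∀ x : R, r * x = 0 → x = 0) (n : ℕ) {x y : R}
    (h : r ^ n * x = r ^ n * y) : x = y := by
  induction n with
  | zero => simpa using h
  | succ n ih =>
    apply ih
    rw [pow_succ', mul_assoc, mul_assoc] at h
    exact sub_eq_zero.1 (hr _ (by rw [mul_sub, h, sub_self]))

theorem mk_smul' (c s t : R) : s • (Ideal.Quotient.mk (Ideal.span {c}) t) =
      Ideal.Quotient.mk (Ideal.span {c}) (s * t) := rfl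

theorem mk_eq' (c s t : R) : (Ideal.Quotient.mk (Ideal.span {c}) s) =
      Ideal.Quotient.mk (Ideal.span {c}) t ↔ ∃ z, s = t + c * z := by
  rw [Ideal.Quotient.eq, Ideal.mem_span_singleton]
  exact exists_congr fun z => sub_eq_iff_eq_add'

theorem fp_cyc (a : R) : Module.FinitePresentation R (R ⧸ (Ideal.span {a} : Ideal R)) := by
  refine Module.finitePresentation_of_surjective (Ideal.span {a} : Ideal R).mkQ
    (Submodule.mkQ_surjective _) ?_
  rw [Submodule.ker_mkQ]
  exact Submodule.fg_span_singleton a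

/-- graded piece criterion: if `S` pulls back to `(r)` then we get `R/r` -/
theorem sf_cyc {r a : R} {n : ℕ}
    (h : ∀ t : R, (∃ y z : R, r ^ n * t = r ^ (n + 1) * y + a * z) ↔ ∃ c, t = r * c) :
    SF r ((R ⧸ (Ideal.span {a} : Ideal R)) ⧸ S r (R ⧸ (Ideal.span {a} : Ideal R)) n) := by
  let f : R →ₗ[R] ((R ⧸ (Ideal.span {a} : Ideal R)) ⧸ S r (R ⧸ (Ideal.span {a} : Ideal R)) n) :=
    (S r (R ⧸ (Ideal.span {a} : Ideal R)) n).mkQ ∘ₗ (Ideal.span {a} : Ideal R).mkQ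
  have hf : Function.Surjective f :=
    (Submodule.mkQ_surjective _).comp (Submodule.mkQ_surjective _)
  have hk : (Ideal.span {r} : Ideal R) = LinearMap.ker f := by
    ext t
    rw [Ideal.mem_span_singleton]
    rw [LinearMap.mem_ker, LinearMap.comp_apply, Submodule.mkQ_apply (S r _ n),
      Submodule.Quotient.mk_eq_zero, mem_S]
    refine (h t).symm.trans ?_
    constructor
    · rintro ⟨y, z, hyz⟩
      exact ⟨Ideal.Quotient.mk _ y, (mk_eq' a _ _).2 ⟨z, hyz⟩⟩
    · rintro ⟨y, hy⟩
      obtain ⟨y, rfl⟩ := Ideal.Quotient.mk_surjective y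
      obtain ⟨z, hz⟩ := (mk_eq' a (r ^ n * t) (r ^ (n + 1) * y)).1 hy
      exact ⟨y, z, hz⟩
  exact SF.self.congr ((Submodule.quotEquivOfEq _ _ hk) ≪≫ₗ f.quotKerEquivOfSurjective hf)

theorem T_cyc {r : R} (hr : ∀ x : R, r * x = 0 → x = 0) (a : R)
    (ha : a = 0 ∨ ∃ k : ℕ, a = r ^ k) : T r (R ⧸ (Ideal.span {a} : Ideal R)) := by
  refine ⟨fp_cyc a, ?_, ?_⟩
  · intro n
    have hback : ∀ t : R, (∃ c, t = r * c) → ∃ y z : R, r ^ n * t = r ^ (n + 1) * y + a * z := by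
      rintro t ⟨c, rfl⟩
      exact ⟨c, 0, by ring⟩
    rcases ha with rfl | ⟨k, rfl⟩
    · refine sf_cyc fun t => ⟨?_, hback t⟩
      rintro ⟨y, z, h⟩
      exact ⟨y, pow_cancel hr n (by rw [h]; ring)⟩
    · by_cases hkn : k ≤ n
      · have : Subsingleton ((R ⧸ (Ideal.span {r ^ k} : Ideal R)) ⧸
            S r (R ⧸ (Ideal.span {r ^ k} : Ideal R)) n) := by
          rw [Submodule.Quotient.subsingleton_iff, eq_top_iff]
          intro x _
          obtain ⟨t, rfl⟩ := Ideal.Quotient.mk_surjective x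
          obtain ⟨m, rfl⟩ := Nat.exists_eq_add_of_le hkn
          refine mem_S.2 ⟨0, ?_⟩
          rw [smul_zero, mk_smul', Ideal.Quotient.eq_zero_iff_mem, Ideal.mem_span_singleton]
          exact ⟨r ^ m * t, by ring⟩
        exact SF.zero
      · obtain ⟨m, rfl⟩ := Nat.exists_eq_add_of_lt (not_le.1 hkn)
        refine sf_cyc fun t => ⟨?_, hback t⟩
        rintro ⟨y, z, h⟩
        exact ⟨y + r ^ m * z, pow_cancel hr n (by rw [h]; ring)⟩
  · rcases ha with rfl | ⟨k, rfl⟩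
    · refine ⟨1, le_rfl, ?_⟩
      rintro x ⟨k, hk⟩
      obtain ⟨t, rfl⟩ := Ideal.Quotient.mk_surjective x
      rw [mk_smul', Ideal.Quotient.eq_zero_iff_mem, Ideal.mem_span_singleton, zero_dvd_iff] at hk
      have : t = 0 := pow_cancel hr k (by rw [hk, mul_zero])
      rw [this, map_zero, smul_zero]
    · refine ⟨k + 1, by omega, ?_⟩
      rintro x -
      obtain ⟨t, rfl⟩ := Ideal.Quotient.mk_surjective x
      rw [mk_smul', Ideal.Quotient.eq_zero_iff_mem, Ideal.mem_span_singleton]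
      exact ⟨r * t, by ring⟩

theorem cyc_ext {X : Type u} [AddCommGroup X] [Module R X] {a : R}
    {f g : (R ⧸ (Ideal.span {a} : Ideal R)) →ₗ[R] X}
    (h : f (Ideal.Quotient.mk _ 1) = g (Ideal.Quotient.mk _ 1)) : f = g := by
  apply LinearMap.ext
  intro x
  obtain ⟨t, rfl⟩ := Ideal.Quotient.mk_surjective x
  have : Ideal.Quotient.mk (Ideal.span {a}) t = t • Ideal.Quotient.mk (Ideal.span {a}) 1 := by
    rw [mk_smul', mul_one]
  rw [this, map_smul, map_smul, h]

theorem T_hom_cyc {r : R} (hr : ∀ x : R, r * x = 0 → x = 0) (a b : R)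
    (ha : a = 0 ∨ ∃ k : ℕ, a = r ^ (k + 1)) (hb : b = 0 ∨ ∃ k : ℕ, b = r ^ (k + 1)) :
    T r ((R ⧸ (Ideal.span {a} : Ideal R)) →ₗ[R] (R ⧸ (Ideal.span {b} : Ideal R))) := by
  have hkill : ∀ f : (R ⧸ (Ideal.span {a} : Ideal R)) →ₗ[R] (R ⧸ (Ideal.span {b} : Ideal R)),
      a • f (Ideal.Quotient.mk _ 1) = 0 := by
    intro f
    rw [← map_smul, mk_smul', Ideal.Quotient.eq_zero_iff_mem.2, map_zero]
    rw [mul_one]; exact Ideal.mem_span_singleton_self a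
  -- a general criterion
  have crit : ∀ (c w : R), (c = 0 ∨ ∃ k : ℕ, c = r ^ k) → (∃ z, a * w = b * z) →
      (∀ y, (∃ z, a * y = b * z) → ∃ x z, y = x * w + b * z) →
      (∀ x, (∃ z, x * w = b * z) ↔ ∃ z, x = c * z) →
      T r ((R ⧸ (Ideal.span {a} : Ideal R)) →ₗ[R] (R ⧸ (Ideal.span {b} : Ideal R))) := by
    intro c w hc hw hsurj hker
    let f₀ : (R ⧸ (Ideal.span {a} : Ideal R)) →ₗ[R] (R ⧸ (Ideal.span {b} : Ideal R)) :=
      cycMap a (Ideal.Quotient.mk _ w) (by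
        rw [mk_smul', Ideal.Quotient.eq_zero_iff_mem, Ideal.mem_span_singleton]
        exact hw)
    have hf₀ : f₀ (Ideal.Quotient.mk _ 1) = Ideal.Quotient.mk _ w := by
      rw [cycMap_mk, one_smul]
    let h : R →ₗ[R] ((R ⧸ (Ideal.span {a} : Ideal R)) →ₗ[R] (R ⧸ (Ideal.span {b} : Ideal R))) :=
      LinearMap.toSpanSingleton R _ f₀
    have hh : ∀ x, h x (Ideal.Quotient.mk _ 1) = Ideal.Quotient.mk _ (x * w) := by
      intro x
      change x • f₀ (Ideal.Quotient.mk _ 1) = _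
      rw [hf₀, mk_smul']
    have hs : Function.Surjective h := by
      intro f
      obtain ⟨y, hy⟩ := Ideal.Quotient.mk_surjective (f (Ideal.Quotient.mk _ 1))
      have h1 := hkill f
      rw [← hy, mk_smul', Ideal.Quotient.eq_zero_iff_mem, Ideal.mem_span_singleton] at h1
      obtain ⟨x, z, hx⟩ := hsurj y h1
      refine ⟨x, cyc_ext ?_⟩
      rw [hh, ← hy]
      exact ((mk_eq' b _ _).2 ⟨z, hx⟩).symm
    have hk : (Ideal.span {c} : Ideal R) = LinearMap.ker h := by
      ext x
      rw [Ideal.mem_span_singleton, LinearMap.mem_ker]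
      refine (hker x).symm.trans ?_
      constructor
      · intro hx
        apply cyc_ext
        rw [hh, LinearMap.zero_apply, Ideal.Quotient.eq_zero_iff_mem, Ideal.mem_span_singleton]
        exact hx
      · intro hx
        have := hh x
        rw [hx, LinearMap.zero_apply, eq_comm, Ideal.Quotient.eq_zero_iff_mem,
          Ideal.mem_span_singleton] at this
        exact this
    exact (T_cyc hr c hc).congr
      ((Submodule.quotEquivOfEq _ _ hk) ≪≫ₗ h.quotKerEquivOfSurjective hs)
  rcases ha with rfl | ⟨k, rfl⟩
  · refine crit b 1 (hb.imp_right fun ⟨k, hk⟩ => ⟨k + 1, hk⟩) ⟨0, by simp⟩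
      (fun y _ => ⟨y, 0, by simp⟩) (fun x => by simp)
  rcases hb with rfl | ⟨l, rfl⟩
  · refine crit 1 0 (Or.inr ⟨0, by simp⟩) ⟨0, by simp⟩ ?_ (fun x => by simp)
    rintro y ⟨z, hz⟩
    refine ⟨0, 0, ?_⟩
    have : y = 0 := pow_cancel hr (k + 1) (by rw [hz]; simp)
    simp [this]
  by_cases hkl : k ≤ l
  · obtain ⟨m, rfl⟩ := Nat.exists_eq_add_of_le hkl
    refine crit (r ^ (k + 1)) (r ^ m) (Or.inr ⟨_, rfl⟩) ⟨1, by ring⟩ ?_ ?_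
    · rintro y ⟨z, hz⟩
      exact ⟨z, 0, pow_cancel hr (k + 1) (by rw [hz]; ring)⟩
    · intro x
      constructor
      · rintro ⟨z, hz⟩
        exact ⟨z, pow_cancel hr m (by rw [mul_comm, hz]; ring)⟩
      · rintro ⟨z, rfl⟩
        exact ⟨z, by ring⟩
  · obtain ⟨m, rfl⟩ := Nat.exists_eq_add_of_lt (not_le.1 hkl)
    exact crit (r ^ (l + 1)) 1 (Or.inr ⟨_, rfl⟩) ⟨r ^ (m + 1), by ring⟩
      (fun y _ => ⟨y, 0, by simp⟩) (fun x => by simp)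

theorem T_hom {r : R} (hr : ∀ x : R, r * x = 0 → x = 0) {E E' : Type u} [AddCommGroup E]
    [Module R E] [AddCommGroup E'] [Module R E'] (h : Good r E) (h' : Good r E') :
    T r (E →ₗ[R] E') := by
  induction h with
  | zero X h =>
    have : Subsingleton (X →ₗ[R] E') := ⟨fun f g => LinearMap.ext fun x => by
      rw [Subsingleton.elim x 0, map_zero, map_zero]⟩
    exact T.zero
  | prod X Y hX hY ihX ihY => exact (ihX.prod ihY).congr (LinearMap.coprodEquiv R)
  | iso X Y hX e ih => exact ih.congr (LinearEquiv.arrowCongr e (LinearEquiv.refl R E'))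
  | cyc a ha =>
    induction h' with
    | zero X h =>
      have : Subsingleton ((R ⧸ (Ideal.span {a} : Ideal R)) →ₗ[R] X) :=
        ⟨fun f g => LinearMap.ext fun x => Subsingleton.elim _ _⟩
      exact T.zero
    | prod X Y hX hY ihX ihY => exact (ihX.prod ihY).congr (LinearMap.prodEquiv R)
    | iso X Y hX e ih => exact ih.congr (LinearEquiv.arrowCongr (LinearEquiv.refl R _) e)
    | cyc b hb => exact T_hom_cyc hr a b ha hb

end C

end Dev

/-- part of Proposition `monoidal_on_detaledv`: assuming every finitely
generated projective `R/rR`-module is stably free, the `R`-module `Hom_R(D₁, D₂)` of two finitely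
presented modules with finite projective `(r,μ)`-dévissage and bounded `r^∞`-torsion is again
finitely presented with finite projective `(r,μ)`-dévissage and bounded `r^∞`-torsion. -/
theorem hom_devissage {R : Type u} [CommRing R] (r : R) (hR : IsDevissageSetup R r)
    (hK0 : ∀ (P : Type u) (_ : AddCommGroup P) (_ : Module (R ⧸ (Ideal.span {r} : Ideal R)) P),
      Module.Finite (R ⧸ (Ideal.span {r} : Ideal R)) P →
      Module.Projective (R ⧸ (Ideal.span {r} : Ideal R)) P →
      ∃ k d : ℕ, Nonempty ((P × (Fin k → R ⧸ (Ideal.span {r} : Ideal R)))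
        ≃ₗ[R ⧸ (Ideal.span {r} : Ideal R)] (Fin d → R ⧸ (Ideal.span {r} : Ideal R))))
    (D₁ : Type u) [AddCommGroup D₁] [Module R D₁]
    (h1fp : Module.FinitePresentation R D₁) (h1dev : HasFinProjMuDevissage r D₁)
    (h1bd : BoundedRTorsion r D₁)
    (D₂ : Type u) [AddCommGroup D₂] [Module R D₂]
    (h2fp : Module.FinitePresentation R D₂) (h2dev : HasFinProjMuDevissage r D₂)
    (h2bd : BoundedRTorsion r D₂) :
    Module.FinitePresentation R (D₁ →ₗ[R] D₂) ∧
    HasFinProjMuDevissage r (D₁ →ₗ[R] D₂) ∧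
    BoundedRTorsion r (D₁ →ₗ[R] D₂) := by
  obtain ⟨N₁, -, hN₁⟩ := h1bd
  obtain ⟨N₂, -, hN₂⟩ := h2bd
  have : Module.Finite R D₁ := inferInstance
  have : Module.Finite R D₂ := inferInstance
  obtain ⟨F₁, _, _, E₁, _, _, hF₁, hE₁, ⟨e₁⟩⟩ :=
    Dev.decomp_thm hR N₁ D₁ (Dev.sf_of_dev hK0 h1dev) hN₁
  obtain ⟨F₂, _, _, E₂, _, _, hF₂, hE₂, ⟨e₂⟩⟩ :=
    Dev.decomp_thm hR N₂ D₂ (Dev.sf_of_dev hK0 h2dev) hN₂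
  -- reduce to the source
  have key : ∀ (Y : Type u) [AddCommGroup Y] [Module R Y], Dev.Good r Y →
      Dev.T r (D₁ →ₗ[R] Y) := by
    intro Y _ _ hY
    refine Dev.T.cancel (Y := F₁ →ₗ[R] Y) ?_ (Dev.T_hom hR.torsionFree hF₁ hY)
    refine (Dev.T_hom hR.torsionFree hE₁ hY).congr ?_
    exact (LinearEquiv.arrowCongr e₁.symm (LinearEquiv.refl R Y)) ≪≫ₗ
      (LinearMap.coprodEquiv R).symm
  have main : Dev.T r (D₁ →ₗ[R] D₂) := by
    refine Dev.T.cancel (Y := D₁ →ₗ[R] F₂) ?_ (key F₂ hF₂)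
    refine (key E₂ hE₂).congr ?_
    exact (LinearEquiv.arrowCongr (LinearEquiv.refl R D₁) e₂.symm) ≪≫ₗ
      (LinearMap.prodEquiv R).symm
  exact ⟨main.1, Dev.dev_of_sf main.2.1, main.2.2⟩
end

section
/- Let (R, r) be a dévissage setup, let a : R → T be a ring homomorphism to a commutative ring T, and suppose (T, a(r)) is also a dévissage setup (T is a(r)-torsion-free, a(r)-adically complete and separated). If D is a finitely presented R-module with finite projective (r,μ)-dévissage and bounded r^∞-torsion, then T ⊗_R D is a finitely presented T-module with finite projective (a(r),μ)-dévissage and bounded a(r)^∞-torsion; moreover for every n ≥ 0 the natural map T ⊗_R (rⁿD) → T ⊗_R D is injective with image a(r)ⁿ(T ⊗_R D), and (T ⊗_R D)[a(r)ⁿ] = T ⊗_R (D[rⁿ]). -/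
open Pointwise

universe u

open TensorProduct in
theorem aux_core_injective {R : Type u} [CommRing R] (r : R) (T : Type u) [AddCommGroup T]
    [Module R T] (hT : ∀ t : T, r • t = 0 → t = 0)
    {A B G F : Type u} [AddCommGroup A] [Module R A] [AddCommGroup B] [Module R B]
    [AddCommGroup G] [Module R G] [AddCommGroup F] [Module R F] [Module.Flat R F]
    [Module.Projective R F]
    (f : A →ₗ[R] B) (g : B →ₗ[R] G) (hf : Function.Injective f) (hg : Function.Surjective g)
    (hfg : Function.Exact f g) (q : F →ₗ[R] G) (hq : Function.Surjective q)
    (hker : ∀ x, q x = 0 ↔ ∃ y, x = r • y) :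
    Function.Injective (LinearMap.lTensor T f) := by
  obtain ⟨s, hs⟩ := Module.projective_lifting_property g q hg
  have hs' : ∀ x, g (s x) = q x := fun x => LinearMap.congr_fun hs x
  -- the map `Psi : F → A` with `f (Psi x) = r • s x`
  have hmem : ∀ x : F, (r • s) x ∈ LinearMap.range f := by
    intro x
    have : g (r • s x) = 0 := by rw [map_smul, hs', ← map_smul]; exact (hker _).2 ⟨x, rfl⟩
    exact (hfg _).1 this
  let e := LinearEquiv.ofInjective f hf
  let Psi : F →ₗ[R] A := e.symm.toLinearMap ∘ₗ (r • s).codRestrict _ hmem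
  have hPsi : ∀ x, f (Psi x) = r • s x := by
    intro x
    have : e (Psi x) = (r • s).codRestrict _ hmem x := by simp [Psi]
    have := congrArg Subtype.val this
    simpa [e] using this
  let al : F →ₗ[R] A × F := Psi.prod (-(r • LinearMap.id))
  let be : A × F →ₗ[R] B := f.coprod s
  have hbe : Function.Surjective be := by
    intro b
    obtain ⟨x, hx⟩ := hq (g b)
    have : g (b - s x) = 0 := by rw [map_sub, hs', hx, sub_self]
    obtain ⟨a, ha⟩ := (hfg _).1 this
    exact ⟨(a, x), by simp [be, ha]⟩
  have hex : Function.Exact al be := by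
    rintro ⟨a, x⟩
    constructor
    · intro h
      have h1 : f a + s x = 0 := by simpa [be] using h
      have h2 : q x = 0 := by
        have := congrArg g h1
        rwa [map_add, hs', hfg.apply_apply_eq_zero, zero_add, map_zero] at this
      obtain ⟨y, rfl⟩ := (hker _).1 h2
      refine ⟨-y, ?_⟩
      have : a = - Psi y := by
        apply hf
        rw [map_neg, hPsi, eq_neg_iff_add_eq_zero, ← map_smul, h1]
      simp [al, this]
    · rintro ⟨y, hy⟩
      rw [← hy]
      simp [al, be, hPsi]
  have hex' := lTensor_exact T hex hbe
  rw [injective_iff_map_eq_zero]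
  intro x hx
  have h1 : LinearMap.lTensor T be (LinearMap.lTensor T (LinearMap.inl R A F) x) = 0 := by
    rw [← LinearMap.lTensor_comp_apply]
    have : be ∘ₗ LinearMap.inl R A F = f := by simp [be]
    rw [this, hx]
  obtain ⟨w, hw⟩ := (hex' _).1 h1
  have h2 : r • w = 0 := by
    have := congrArg (LinearMap.lTensor T (LinearMap.snd R A F)) hw
    rw [← LinearMap.lTensor_comp_apply, ← LinearMap.lTensor_comp_apply] at this
    have e1 : LinearMap.snd R A F ∘ₗ al = -(r • LinearMap.id) := by simp [al]
    have e2 : LinearMap.snd R A F ∘ₗ LinearMap.inl R A F = 0 := by simp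
    rw [e1, e2] at this
    simpa using this
  have h3 : w = 0 := by
    have hinj : Function.Injective (r • LinearMap.id : T →ₗ[R] T) := by
      rw [injective_iff_map_eq_zero]
      intro t ht
      exact hT t (by simpa using ht)
    have := Module.Flat.rTensor_preserves_injective_linearMap (M := F) _ hinj
    rw [injective_iff_map_eq_zero] at this
    apply this
    rw [LinearMap.rTensor_smul]
    simpa using h2
  have h4 := congrArg (LinearMap.lTensor T (LinearMap.fst R A F)) hw
  rw [h3, ← LinearMap.lTensor_comp_apply T (LinearMap.fst R A F) (LinearMap.inl R A F),
    LinearMap.fst_comp_inl] at h4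
  simpa using h4.symm

open TensorProduct in
theorem aux_mid_injective {R : Type u} [CommRing R] (r : R) (T : Type u) [AddCommGroup T]
    [Module R T] (hT : ∀ t : T, r • t = 0 → t = 0)
    {A B Q G F : Type u} [AddCommGroup A] [Module R A] [AddCommGroup B] [Module R B]
    [AddCommGroup Q] [Module R Q]
    [AddCommGroup G] [Module R G] [AddCommGroup F] [Module R F] [Module.Flat R F]
    [Module.Projective R F]
    (f : A →ₗ[R] B) (g : B →ₗ[R] Q) (hf : Function.Injective f) (hg : Function.Surjective g)
    (hfg : Function.Exact f g) (i' : Q →ₗ[R] G) (p : G →ₗ[R] Q) (hpi : ∀ x, p (i' x) = x)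
    (q : F →ₗ[R] G) (hq : Function.Surjective q)
    (hker : ∀ x, q x = 0 ↔ ∃ y, x = r • y) :
    Function.Injective (LinearMap.lTensor T f) := by
  let B' := LinearMap.ker (g ∘ₗ LinearMap.fst R B G - p ∘ₗ LinearMap.snd R B G)
  have hB' : ∀ x, x ∈ B' ↔ g x.1 = p x.2 := by
    intro x; simp [B', sub_eq_zero]
  let j : B →ₗ[R] B' := (LinearMap.id.prod (i' ∘ₗ g)).codRestrict B' (by
    intro x; rw [hB']; simp [hpi])
  have key : Function.Injective (LinearMap.lTensor T (j ∘ₗ f)) := by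
    refine aux_core_injective r T hT (j ∘ₗ f) (LinearMap.snd R B G ∘ₗ B'.subtype) ?_ ?_ ?_ q hq hker
    · intro x y hxy
      apply hf
      have := congrArg (fun z => z.1.1) hxy
      simpa [j] using this
    · intro y
      obtain ⟨b, hb⟩ := hg (p y)
      exact ⟨⟨(b, y), (hB' _).2 hb⟩, rfl⟩
    · rintro ⟨⟨b, y⟩, hy⟩
      rw [hB'] at hy
      constructor
      · intro h
        have h : y = 0 := h
        subst h
        obtain ⟨a, rfl⟩ := (hfg b).1 (by simpa using hy)
        refine ⟨a, Subtype.ext ?_⟩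
        simp [j, hfg.apply_apply_eq_zero]
      · rintro ⟨a, ha⟩
        have := congrArg (fun z => z.1.2) ha
        simp [j, hfg.apply_apply_eq_zero] at this
        simpa using this.symm
  rw [LinearMap.lTensor_comp] at key
  exact Function.Injective.of_comp key

open TensorProduct in
theorem aux_injective {R : Type u} [CommRing R] (r : R) (T : Type u) [AddCommGroup T]
    [Module R T] (hT : ∀ t : T, r • t = 0 → t = 0)
    {A B Q : Type u} [AddCommGroup A] [Module R A] [AddCommGroup B] [Module R B]
    [AddCommGroup Q] [Module R Q] [Module (R ⧸ Ideal.span {r}) Q]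
    [IsScalarTower R (R ⧸ Ideal.span {r}) Q] [Module.Projective (R ⧸ Ideal.span {r}) Q]
    (f : A →ₗ[R] B) (g : B →ₗ[R] Q) (hf : Function.Injective f) (hg : Function.Surjective g)
    (hfg : Function.Exact f g) :
    Function.Injective (LinearMap.lTensor T f) := by
  obtain ⟨i, hi⟩ := Module.projective_def.1
    (inferInstance : Module.Projective (R ⧸ Ideal.span {r}) Q)
  let i' : Q →ₗ[R] (Q →₀ (R ⧸ Ideal.span {r})) := i.restrictScalars R
  let p : (Q →₀ (R ⧸ Ideal.span {r})) →ₗ[R] Q :=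
    (Finsupp.linearCombination (R ⧸ Ideal.span {r}) id).restrictScalars R
  have hpi : ∀ x, p (i' x) = x := hi
  let q : (Q →₀ R) →ₗ[R] (Q →₀ (R ⧸ Ideal.span {r})) :=
    Finsupp.mapRange.linearMap (Submodule.mkQ (Ideal.span {r}))
  refine aux_mid_injective r T hT f g hf hg hfg i' p hpi q ?_ ?_
  · exact Finsupp.mapRange_surjective _ (map_zero _) (Submodule.mkQ_surjective _)
  · intro x
    constructor
    · intro h
      have h1 : ∀ k, ∃ c, x k = r * c := by
        intro k
        have := DFunLike.congr_fun h k
        have : (Submodule.mkQ (Ideal.span {r})) (x k) = 0 := by simpa [q] using this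
        rw [Submodule.mkQ_apply, Submodule.Quotient.mk_eq_zero, Ideal.mem_span_singleton] at this
        exact this
      choose c hc using h1
      classical
      refine ⟨Finsupp.onFinset x.support (fun k => if x k = 0 then 0 else c k) ?_, ?_⟩
      · intro k hk
        simp at hk
        simp [hk.1]
      · ext k
        by_cases hk : x k = 0
        · simp [hk]
        · simp [hk, ← hc]
    · rintro ⟨y, rfl⟩
      ext k
      have : (Submodule.mkQ (Ideal.span {r})) (r * y k) = 0 := by
        rw [Submodule.mkQ_apply, Submodule.Quotient.mk_eq_zero, Ideal.mem_span_singleton]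
        exact ⟨_, rfl⟩
      exact this

open TensorProduct in
theorem FinProjConstRank.baseChange_equiv {A S : Type u} [CommRing A] [CommRing S] [Algebra A S]
    {Q N : Type u} [AddCommGroup Q] [Module A Q] [AddCommGroup N] [Module S N]
    (h : FinProjConstRank A Q) (e : (S ⊗[A] Q) ≃ₗ[S] N) : FinProjConstRank S N := by
  obtain ⟨h1, h2, c, hc⟩ := h
  have i1 : Module.Finite S N := Module.Finite.equiv e
  have i2 : Module.Projective S N := Module.Projective.of_equiv e
  refine ⟨i1, i2, c, ?_⟩
  intro p hp
  have hr : Module.rankAtStalk N (⟨p, hp⟩ : PrimeSpectrum S) = c := by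
    rw [← Module.rankAtStalk_eq_of_equiv e, Module.rankAtStalk_baseChange]
    obtain ⟨e'⟩ := hc (PrimeSpectrum.comap (algebraMap A S) ⟨p, hp⟩).asIdeal inferInstance
    have := e'.finrank_eq
    rw [Module.finrank_fin_fun] at this
    exact this
  have : Module.Free (Localization.AtPrime p) (LocalizedModule p.primeCompl N) :=
    Module.free_of_flat_of_isLocalRing
  have hr' : Module.finrank (Localization.AtPrime p) (LocalizedModule p.primeCompl N) = c := hr
  refine ⟨LinearEquiv.ofFinrankEq _ _ ?_⟩
  rw [hr', Module.finrank_fin_fun]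

open TensorProduct in
theorem aux_equiv {R T A S : Type u} [CommRing R] [CommRing T] [CommRing A] [CommRing S]
    [Algebra R T] [Algebra R A] [Algebra R S] [Algebra T S] [Algebra A S]
    [IsScalarTower R T S] [IsScalarTower R A S]
    (hA : Function.Surjective (algebraMap R A)) (hS : Function.Surjective (algebraMap T S))
    {E' E Q N : Type u} [AddCommGroup E'] [Module R E'] [AddCommGroup E] [Module R E]
    [AddCommGroup Q] [Module R Q] [Module A Q] [IsScalarTower R A Q]
    [AddCommGroup N] [Module T N] [Module S N] [IsScalarTower T S N]
    (j : E' →ₗ[R] E) (pi : E →ₗ[R] Q) (hpi : Function.Surjective pi) (hj : Function.Exact j pi)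
    (th : T ⊗[R] E →ₗ[T] N) (hth : Function.Surjective th)
    (hker : ∀ x, th x = 0 ↔ x ∈ LinearMap.range (LinearMap.lTensor T j)) :
    Nonempty ((S ⊗[A] Q) ≃ₗ[S] N) := by
  let _ : Module A N := Module.compHom N (algebraMap A S)
  have : IsScalarTower A S N := ⟨fun a s n => by
    rw [Algebra.smul_def, mul_smul]; rfl⟩
  let _ : Module R N := Module.compHom N (algebraMap R T)
  have : IsScalarTower R T N := ⟨fun a s n => by
    rw [Algebra.smul_def, mul_smul]; rfl⟩
  have : IsScalarTower R A N := ⟨fun x a n => by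
    have h1 : (x • a) • n = (algebraMap A S (x • a)) • n := rfl
    have h2 : x • a • n = algebraMap R T x • algebraMap A S a • n := rfl
    rw [h1, h2, Algebra.smul_def, map_mul, mul_smul, ← IsScalarTower.algebraMap_apply,
      IsScalarTower.algebraMap_apply R T S, algebraMap_smul]⟩
  let h0 : E →ₗ[R] N := (th.restrictScalars R) ∘ₗ (TensorProduct.mk R T E 1)
  have hle : LinearMap.ker pi ≤ LinearMap.ker h0 := by
    intro x hx
    obtain ⟨y, rfl⟩ := (hj x).1 hx
    show th (1 ⊗ₜ j y) = 0
    rw [hker]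
    exact ⟨1 ⊗ₜ y, by simp⟩
  let h1 : Q →ₗ[R] N := (LinearMap.ker pi).liftQ h0 hle ∘ₗ
    (pi.quotKerEquivOfSurjective hpi).symm.toLinearMap
  have hh1 : ∀ x, h1 (pi x) = th (1 ⊗ₜ x) := by
    intro x
    have : (pi.quotKerEquivOfSurjective hpi).symm (pi x) = Submodule.Quotient.mk x := by
      rw [LinearEquiv.symm_apply_eq]; rfl
    simp only [h1, LinearMap.comp_apply, LinearEquiv.coe_coe, this]
    rfl
  let h2 : Q →ₗ[A] N := h1.extendScalarsOfSurjective hA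
  let ph : S ⊗[A] Q →ₗ[S] N := h2.liftBaseChange S
  let rho0 : T →ₗ[R] S := (Algebra.linearMap T S).restrictScalars R
  let rho : T ⊗[R] E →ₗ[R] S ⊗[A] Q :=
    (TensorProduct.mapOfCompatibleSMul A R R S Q) ∘ₗ TensorProduct.map rho0 pi
  have hrho : Function.Surjective rho :=
    (TensorProduct.mapOfCompatibleSMul_surjective A R R S Q).comp
      (TensorProduct.map_surjective hS hpi)
  have hcomp : ∀ x, ph (rho x) = th x := by
    intro x
    induction x using TensorProduct.induction_on with
    | zero => simp
    | add x y hx hy => simp only [map_add, hx, hy]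
    | tmul t e =>
      have : ph (rho (t ⊗ₜ e)) = (algebraMap T S t) • h1 (pi e) := rfl
      rw [this, hh1, algebraMap_smul, ← map_smul, TensorProduct.smul_tmul', smul_eq_mul, mul_one]
  refine ⟨LinearEquiv.ofBijective ph ⟨?_, ?_⟩⟩
  · rw [injective_iff_map_eq_zero]
    intro z hz
    obtain ⟨w, rfl⟩ := hrho z
    rw [hcomp, hker] at hz
    obtain ⟨v, rfl⟩ := hz
    induction v using TensorProduct.induction_on with
    | zero => simp
    | add x y hx hy => simp only [map_add, hx, hy, add_zero]
    | tmul t e =>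
      show (algebraMap T S t) ⊗ₜ[A] (pi (j e)) = 0
      rw [hj.apply_apply_eq_zero, TensorProduct.tmul_zero]
  · intro n
    obtain ⟨w, rfl⟩ := hth n
    exact ⟨rho w, hcomp w⟩

section Aux

open TensorProduct

variable {R : Type u} [CommRing R] (r : R) (D : Type u) [AddCommGroup D] [Module R D]

theorem aux_mem_pow (n : ℕ) (x : D) :
    x ∈ r ^ n • (⊤ : Submodule R D) ↔ ∃ y, r ^ n • y = x := by
  rw [Submodule.mem_smul_pointwise_iff_exists]
  simp

theorem aux_le (n : ℕ) : r ^ (n + 1) • (⊤ : Submodule R D) ≤ r ^ n • (⊤ : Submodule R D) := by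
  intro x hx
  obtain ⟨y, rfl⟩ := (aux_mem_pow r D _ _).1 hx
  exact (aux_mem_pow r D _ _).2 ⟨r • y, by rw [smul_smul, pow_succ]⟩

/-- The projection `rⁿD → rⁿD/rⁿ⁺¹D`. -/
def auxProj (n : ℕ) : (r ^ n • (⊤ : Submodule R D) : Submodule R D) →ₗ[R] muQuotSub r D n :=
  (r ^ (n + 1) • (⊤ : Submodule R D)).mkQ.submoduleMap (r ^ n • (⊤ : Submodule R D))

theorem auxProj_surjective (n : ℕ) : Function.Surjective (auxProj r D n) :=
  LinearMap.submoduleMap_surjective _ _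

theorem auxProj_eq_zero (n : ℕ) (x : (r ^ n • (⊤ : Submodule R D) : Submodule R D)) :
    auxProj r D n x = 0 ↔ (x : D) ∈ r ^ (n + 1) • (⊤ : Submodule R D) := by
  rw [← Submodule.Quotient.mk_eq_zero, Subtype.ext_iff]
  rfl

theorem auxProj_exact (n : ℕ) :
    Function.Exact (Submodule.inclusion (aux_le r D n)) (auxProj r D n) := by
  intro x
  rw [auxProj_eq_zero]
  constructor
  · intro h
    exact ⟨⟨x, h⟩, rfl⟩
  · rintro ⟨y, rfl⟩
    exact y.2

/-- Multiplication by `rⁿ` as a map onto `rⁿD`. -/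
def auxMul (n : ℕ) : D →ₗ[R] (r ^ n • (⊤ : Submodule R D) : Submodule R D) :=
  (r ^ n • LinearMap.id).codRestrict _ (fun x => (aux_mem_pow r D n _).2 ⟨x, rfl⟩)

theorem auxMul_surjective (n : ℕ) : Function.Surjective (auxMul r D n) := by
  rintro ⟨x, hx⟩
  obtain ⟨y, rfl⟩ := (aux_mem_pow r D n _).1 hx
  exact ⟨y, rfl⟩

theorem subtype_comp_auxMul (n : ℕ) :
    (r ^ n • (⊤ : Submodule R D)).subtype ∘ₗ auxMul r D n = r ^ n • LinearMap.id := rfl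

variable (T : Type u) [CommRing T] [Algebra R T]

theorem aux_lTensor_mul (n : ℕ) (x : T ⊗[R] D) :
    LinearMap.lTensor T (r ^ n • (⊤ : Submodule R D)).subtype
      (LinearMap.lTensor T (auxMul r D n) x) = (algebraMap R T r) ^ n • x := by
  rw [← LinearMap.lTensor_comp_apply, subtype_comp_auxMul, LinearMap.lTensor_smul, ← map_pow,
    algebraMap_smul]
  simp

theorem aux_range (n : ℕ) (x : T ⊗[R] D) :
    x ∈ LinearMap.range (LinearMap.lTensor T ((r ^ n • (⊤ : Submodule R D)).subtype)) ↔
      x ∈ (algebraMap R T r) ^ n • (⊤ : Submodule T (TensorProduct R T D)) := by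
  rw [aux_mem_pow]
  constructor
  · rintro ⟨y, rfl⟩
    obtain ⟨z, rfl⟩ := LinearMap.lTensor_surjective T (auxMul_surjective r D n) y
    exact ⟨z, (aux_lTensor_mul r D T n z).symm⟩
  · rintro ⟨y, rfl⟩
    exact ⟨_, aux_lTensor_mul r D T n y⟩

theorem aux_inj (hT : ∀ t : T, algebraMap R T r * t = 0 → t = 0)
    (hdev : HasFinProjMuDevissage r D) (n : ℕ) :
    Function.Injective (LinearMap.lTensor T ((r ^ n • (⊤ : Submodule R D)).subtype)) := by
  induction n with
  | zero =>
    have h : auxMul r D 0 ∘ₗ (r ^ 0 • (⊤ : Submodule R D)).subtype = LinearMap.id := by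
      ext x
      simp [auxMul]
    intro x y hxy
    have := congrArg (LinearMap.lTensor T (auxMul r D 0)) hxy
    rw [← LinearMap.lTensor_comp_apply, ← LinearMap.lTensor_comp_apply, h] at this
    simpa using this
  | succ n ih =>
    have hstep : Function.Injective
        (LinearMap.lTensor T (Submodule.inclusion (aux_le r D n))) := by
      let _ := (muQuotSub_isTorsionBySet r D n).module
      have : IsScalarTower R (R ⧸ Ideal.span {r}) (muQuotSub r D n) :=
        (muQuotSub_isTorsionBySet r D n).isScalarTower
      have : Module.Projective (R ⧸ Ideal.span {r}) (muQuotSub r D n) := (hdev n).2.1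
      refine aux_injective r T ?_ _ (auxProj r D n) (Submodule.inclusion_injective _)
        (auxProj_surjective r D n) (auxProj_exact r D n)
      intro t ht
      exact hT t (by rwa [Algebra.smul_def] at ht)
    have := ih.comp hstep
    rw [← LinearMap.coe_comp, ← LinearMap.lTensor_comp, Submodule.subtype_comp_inclusion] at this
    exact this

theorem aux_torsion (n : ℕ)
    (hinj : Function.Injective (LinearMap.lTensor T ((r ^ n • (⊤ : Submodule R D)).subtype)))
    (x : T ⊗[R] D) :
    x ∈ LinearMap.range (LinearMap.lTensor T (Submodule.torsionBy R D (r ^ n)).subtype) ↔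
      (algebraMap R T r) ^ n • x = 0 := by
  have hex : Function.Exact (Submodule.torsionBy R D (r ^ n)).subtype (auxMul r D n) := by
    intro y
    constructor
    · intro h
      exact ⟨⟨y, (Submodule.mem_torsionBy_iff _ _).2 (congrArg Subtype.val h)⟩, rfl⟩
    · rintro ⟨z, rfl⟩
      exact Subtype.ext ((Submodule.mem_torsionBy_iff _ _).1 z.2)
  have := lTensor_exact T hex (auxMul_surjective r D n) x
  rw [LinearMap.mem_range, ← Set.mem_range, ← this, ← aux_lTensor_mul,
    map_eq_zero_iff _ hinj]

theorem aux_dev (hT : ∀ t : T, algebraMap R T r * t = 0 → t = 0)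
    (hdev : HasFinProjMuDevissage r D) :
    HasFinProjMuDevissage (algebraMap R T r) (T ⊗[R] D) := by
  intro n
  let _ := (muQuotSub_isTorsionBySet r D n).module
  have : IsScalarTower R (R ⧸ Ideal.span {r}) (muQuotSub r D n) :=
    (muQuotSub_isTorsionBySet r D n).isScalarTower
  let _ := (muQuotSub_isTorsionBySet (algebraMap R T r) (T ⊗[R] D) n).module
  have : IsScalarTower T (T ⧸ Ideal.span {algebraMap R T r})
      (muQuotSub (algebraMap R T r) (T ⊗[R] D) n) :=
    (muQuotSub_isTorsionBySet (algebraMap R T r) (T ⊗[R] D) n).isScalarTower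
  let φ : (R ⧸ Ideal.span {r}) →+* (T ⧸ Ideal.span {algebraMap R T r}) :=
    Ideal.quotientMap _ (algebraMap R T) (by
      rw [Ideal.span_le]
      rintro _ rfl
      exact Ideal.mem_span_singleton_self _)
  let _ : Algebra (R ⧸ Ideal.span {r}) (T ⧸ Ideal.span {algebraMap R T r}) := φ.toAlgebra
  have : IsScalarTower R (R ⧸ Ideal.span {r}) (T ⧸ Ideal.span {algebraMap R T r}) :=
    IsScalarTower.of_algebraMap_eq (fun x => rfl)
  have h0 := hdev n
  have hinj := aux_inj r D T hT hdev n
  let sub : T ⊗[R] (r ^ n • (⊤ : Submodule R D) : Submodule R D) →ₗ[T]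
      ((algebraMap R T r) ^ n • (⊤ : Submodule T (T ⊗[R] D)) : Submodule T (T ⊗[R] D)) :=
    ((r ^ n • (⊤ : Submodule R D)).subtype.baseChange T).codRestrict _
      (fun x => (aux_range r D T n _).1 ⟨x, rfl⟩)
  have hsub : ∀ x, (sub x : T ⊗[R] D) =
    LinearMap.lTensor T ((r ^ n • (⊤ : Submodule R D)).subtype) x := fun x => rfl
  obtain ⟨e⟩ := aux_equiv (R := R) (T := T) (A := R ⧸ Ideal.span {r})
    (S := T ⧸ Ideal.span {algebraMap R T r}) Ideal.Quotient.mk_surjective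
    Ideal.Quotient.mk_surjective (Submodule.inclusion (aux_le r D n)) (auxProj r D n)
    (auxProj_surjective r D n) (auxProj_exact r D n)
    (auxProj (algebraMap R T r) (T ⊗[R] D) n ∘ₗ sub)
    (by
      refine (auxProj_surjective _ _ n).comp ?_
      rintro ⟨y, hy⟩
      obtain ⟨x, hx⟩ := (aux_range r D T n _).2 hy
      exact ⟨x, Subtype.ext hx⟩)
    (by
      intro x
      rw [LinearMap.comp_apply, auxProj_eq_zero, hsub, ← aux_range,
        ← Submodule.subtype_comp_inclusion _ _ (aux_le r D n), LinearMap.lTensor_comp]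
      constructor
      · rintro ⟨y, hy⟩
        exact ⟨y, hinj hy⟩
      · rintro ⟨y, rfl⟩
        exact ⟨y, rfl⟩)
  exact FinProjConstRank.baseChange_equiv h0 e

end Aux

/-- Proposition `dvproj_ext`: base change along `a : R → T` of a finitely
presented module with finite projective `(r,μ)`-dévissage and bounded `r^∞`-torsion, when
`(T, a(r))` is again a dévissage setup. -/
theorem baseChange_devissage {R : Type u} [CommRing R] (r : R) (hR : IsDevissageSetup R r)
    (T : Type u) [CommRing T] [Algebra R T]
    (hT : IsDevissageSetup T (algebraMap R T r))
    (D : Type u) [AddCommGroup D] [Module R D]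
    (hfp : Module.FinitePresentation R D) (hdev : HasFinProjMuDevissage r D)
    (hbd : BoundedRTorsion r D) :
    Module.FinitePresentation T (TensorProduct R T D) ∧
    HasFinProjMuDevissage (algebraMap R T r) (TensorProduct R T D) ∧
    BoundedRTorsion (algebraMap R T r) (TensorProduct R T D) ∧
    (∀ n : ℕ,
      Function.Injective (LinearMap.lTensor T ((r ^ n • (⊤ : Submodule R D)).subtype)) ∧
      LinearMap.range (LinearMap.lTensor T ((r ^ n • (⊤ : Submodule R D)).subtype)) =
        Submodule.restrictScalars R
          ((algebraMap R T r) ^ n • (⊤ : Submodule T (TensorProduct R T D))) ∧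
      LinearMap.range (LinearMap.lTensor T (Submodule.torsionBy R D (r ^ n)).subtype) =
        Submodule.restrictScalars R
          (Submodule.torsionBy T (TensorProduct R T D) ((algebraMap R T r) ^ n))) := by
  have hT' := hT.torsionFree
  have htor : ∀ (n : ℕ) (x : TensorProduct R T D),
      x ∈ LinearMap.range (LinearMap.lTensor T (Submodule.torsionBy R D (r ^ n)).subtype) ↔
      (algebraMap R T r) ^ n • x = 0 :=
    fun n x => aux_torsion r D T n (aux_inj r D T hT' hdev n) x
  refine ⟨inferInstance, aux_dev r D T hT' hdev, ?_, fun n => ⟨aux_inj r D T hT' hdev n, ?_, ?_⟩⟩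
  · obtain ⟨N, hN, h⟩ := hbd
    refine ⟨N, hN, ?_⟩
    rintro x ⟨k, hk⟩
    rw [← htor] at hk ⊢
    have hle : Submodule.torsionBy R D (r ^ k) ≤ Submodule.torsionBy R D (r ^ N) := by
      intro y hy
      rw [Submodule.mem_torsionBy_iff] at hy ⊢
      exact h y ⟨k, hy⟩
    obtain ⟨y, rfl⟩ := hk
    rw [← Submodule.subtype_comp_inclusion _ _ hle, LinearMap.lTensor_comp]
    exact ⟨_, rfl⟩
  · ext x
    exact aux_range r D T n x
  · ext x
    rw [htor, Submodule.restrictScalars_mem, Submodule.mem_torsionBy_iff]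
end

section
/- Let S be a monoid acting on a commutative ring R by ring endomorphisms (a multiplicative semiring action), and let R^S = {x ∈ R | ∀ s ∈ S, s • x = x} be the fixed subring. Suppose that for every t ∈ R^S there exists n ≥ 1 such that every element of R killed by some power of t is killed by tⁿ. Let D be a finitely generated projective R^S-module, and let S act on R ⊗_{R^S} D by s • (x ⊗ d) = (s • x) ⊗ d. Then the natural R^S-linear map c : D → (R ⊗_{R^S} D)^S, d ↦ 1 ⊗ d, is an isomorphism onto the submodule of S-fixed elements. -/
universe u

section Fixed

variable (S : Type u) [Monoid S] (R : Type u) [CommRing R] [MulSemiringAction S R]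

/-- The subring of elements of `R` fixed by every element of the monoid `S`. -/
def fixedSubring : Subring R where
  carrier := {x | ∀ s : S, s • x = x}
  mul_mem' := fun {a b} ha hb s => by rw [smul_mul', ha s, hb s]
  one_mem' := fun s => smul_one s
  add_mem' := fun {a b} ha hb s => by rw [smul_add, ha s, hb s]
  zero_mem' := fun s => smul_zero s
  neg_mem' := fun {a} ha s => by rw [smul_neg, ha s]

/-- The action of `s ∈ S` on `R`, as an `R^S`-linear map. -/
def fixedSmulLinear (s : S) : R →ₗ[fixedSubring S R] R where
  toFun x := s • x
  map_add' := smul_add s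
  map_smul' c x := by
    show s • ((c : R) * x) = (c : R) * (s • x)
    rw [smul_mul', c.2 s]

end Fixed

open scoped TensorProduct

/-- Proposition `inv_detale_et_proj`: for a monoid `S` acting on a commutative
ring `R` by ring endomorphisms with bounded `t^∞`-torsion for every `t` in the fixed subring
`R^S`, and a finitely generated projective `R^S`-module `D`, the map `d ↦ 1 ⊗ d` is an
isomorphism of `D` onto the `S`-fixed elements of `R ⊗_{R^S} D`. -/
theorem fixed_points_of_baseChange (S : Type u) [Monoid S] (R : Type u) [CommRing R]
    [MulSemiringAction S R]
    (hbd : ∀ t : fixedSubring S R, ∃ n : ℕ, 1 ≤ n ∧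
      ∀ x : R, (∃ k : ℕ, (t : R) ^ k * x = 0) → (t : R) ^ n * x = 0)
    (D : Type u) [AddCommGroup D] [Module (fixedSubring S R) D]
    [Module.Finite (fixedSubring S R) D] [Module.Projective (fixedSubring S R) D] :
    Function.Injective (TensorProduct.mk (fixedSubring S R) R D 1) ∧
    LinearMap.range (TensorProduct.mk (fixedSubring S R) R D 1) =
      ⨅ s : S, LinearMap.eqLocus (LinearMap.rTensor D (fixedSmulLinear S R s)) LinearMap.id := by
  obtain ⟨n, f, g, -, -, hfg⟩ := Module.Finite.exists_comp_eq_id_of_projective (fixedSubring S R) D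
  have hfg' : ∀ d, f (g d) = d := fun d => LinearMap.congr_fun hfg d
  let G : Fin n → (TensorProduct (fixedSubring S R) R D →ₗ[fixedSubring S R] R) := fun i =>
    (TensorProduct.rid (fixedSubring S R) R).toLinearMap ∘ₗ
      LinearMap.lTensor R ((LinearMap.proj i : (Fin n → fixedSubring S R) →ₗ[_] _) ∘ₗ g)
  have hG : ∀ i x d, G i (x ⊗ₜ[fixedSubring S R] d) = g d i • x := by
    intro i x d
    simp [G]
  have hd : ∀ d, d = ∑ i, g d i • f (Pi.single i 1) := by
    intro d
    conv_lhs => rw [← hfg' d, pi_eq_sum_univ' (g d)]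
    rw [map_sum]
    refine Finset.sum_congr rfl fun i _ => ?_
    rw [map_smul]
  have hz : ∀ z : TensorProduct (fixedSubring S R) R D,
      z = ∑ i, (G i z) ⊗ₜ[fixedSubring S R] f (Pi.single i 1) := by
    intro z
    induction z with
    | zero => simp
    | add a b ha hb =>
      conv_lhs => rw [ha, hb]
      simp only [map_add, TensorProduct.add_tmul, Finset.sum_add_distrib]
    | tmul x d =>
      conv_lhs => rw [hd d]
      simp only [hG, TensorProduct.tmul_sum, TensorProduct.smul_tmul]
  have hs : ∀ i (s : S) z, G i (LinearMap.rTensor D (fixedSmulLinear S R s) z) = s • G i z := by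
    intro i s z
    induction z with
    | zero => simp
    | add a b ha hb => simp only [map_add, smul_add, ha, hb]
    | tmul x d =>
      rw [LinearMap.rTensor_tmul, hG, hG]
      exact ((fixedSmulLinear S R s).map_smul _ _).symm
  constructor
  · rw [injective_iff_map_eq_zero]
    intro d h
    have h0 : g d = 0 := by
      ext i
      have := hG i 1 d
      rw [TensorProduct.mk_apply] at h
      rw [h, map_zero] at this
      simpa [Subring.smul_def] using this.symm
    rw [← hfg' d, h0, map_zero]
  · ext z
    simp only [LinearMap.mem_range, Submodule.mem_iInf, LinearMap.mem_eqLocus]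
    constructor
    · rintro ⟨d, rfl⟩ s
      rw [TensorProduct.mk_apply, LinearMap.rTensor_tmul]
      congr 1
      exact smul_one s
    · intro h
      have hfix : ∀ i, G i z ∈ fixedSubring S R := by
        intro i s
        rw [← hs, h s]
        rfl
      refine ⟨∑ i, (⟨G i z, hfix i⟩ : fixedSubring S R) • f (Pi.single i 1), ?_⟩
      conv_rhs => rw [hz z]
      rw [map_sum]
      refine Finset.sum_congr rfl fun i _ => ?_
      rw [TensorProduct.mk_apply, ← TensorProduct.smul_tmul]
      congr 1
      exact mul_one _
end
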